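/- arXiv:2511.07835 — 3 statements merged into one kernel-verified Lean document; each statement's English description precedes it below -/
import Mathlib

section
/- Let Y be a finitely supported real random variable whose minimum nonzero outcome probability is λ, and let f be a multilinear polynomial of degree at most d in n variables. Then for y drawn from the n-fold product Y^{⊗n}, Pr[f(y) ≥ E[f(y)]] ≥ (1/4)·(2λ/e²)^d. -/
open MeasureTheory

/-- Evaluation of a multilinear polynomial given by its coefficients on subsets of `Fin n`. -/
noncomputable def mlEval {n : ℕ} (coeff : Finset (Fin n) → ℝ) (x : Fin n → ℝ) : ℝ :=
  ∑ S : Finset (Fin n), coeff S * ∏ i ∈ S, x i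


namespace LS

lemma pade {x : ℝ} (hx : -1 < x) : Real.log (1 + x) ≤ x * (6 + x) / (6 + 4 * x) := by
  let h : ℝ → ℝ := fun x => x * (6 + x) / (6 + 4 * x) - Real.log (1 + x)
  have hd : ∀ y : ℝ, -1 < y → HasDerivAt h (y ^ 3 / ((1 + y) * (2 * y + 3) ^ 2)) y := by
    intro y hy
    have h1 : (6 + 4 * y) ≠ 0 := by linarith
    have h2 : (1 + y) ≠ 0 := by linarith
    have h3 : (2 * y + 3) ≠ 0 := by linarith
    have e1 : HasDerivAt (fun x : ℝ => x * (6 + x)) (1 * (6 + y) + y * 1) y :=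
      (hasDerivAt_id' y).mul ((hasDerivAt_id' y).const_add 6)
    have e2 : HasDerivAt (fun x : ℝ => 6 + 4 * x) (4 * 1) y :=
      ((hasDerivAt_id' y).const_mul 4).const_add 6
    have e3 : HasDerivAt (fun x : ℝ => Real.log (1 + x)) (1 / (1 + y)) y :=
      ((hasDerivAt_id' y).const_add 1).log h2
    have e4 := (e1.div e2 h1).sub e3
    refine e4.congr_deriv ?_
    rw [div_sub_div _ _ (by positivity) h2, div_eq_div_iff (by positivity) (by positivity)]
    ring
  have h0 : h 0 = 0 := by simp [h]
  suffices 0 ≤ h x by simp only [h] at this; linarith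
  rw [← h0]
  rcases le_total 0 x with hx0 | hx0
  · have := monotoneOn_of_deriv_nonneg (convex_Ici (0:ℝ)) (f := h)
      (fun y hy => (hd y (by simp at hy; linarith)).continuousAt.continuousWithinAt)
      (fun y hy => (hd y (by simp at hy; linarith)).differentiableAt.differentiableWithinAt)
      (by
        intro y hy
        have hy : 0 < y := by simpa using hy
        rw [(hd y (by linarith)).deriv]
        positivity)
    exact this (by simp) hx0 hx0
  · have := antitoneOn_of_deriv_nonpos (convex_Ioc (-1:ℝ) 0) (f := h)
      (fun y hy => (hd y hy.1).continuousAt.continuousWithinAt)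
      (fun y hy => (hd y (interior_subset hy).1).differentiableAt.differentiableWithinAt)
      (by
        intro y hy
        have hy := interior_subset hy
        rw [(hd y hy.1).deriv]
        apply div_nonpos_of_nonpos_of_nonneg
        · exact Odd.pow_nonpos (by decide) hy.2
        · have := hy.1
          have : 0 ≤ 1 + y := by linarith
          positivity)
    exact this ⟨hx, hx0⟩ (by simp) hx0

/-- (2 - v) e^v ≤ 2 + v -/
lemma exp_aux {v : ℝ} (hv : 0 ≤ v) : (2 - v) * Real.exp v ≤ 2 + v := by
  let h : ℝ → ℝ := fun v => 2 + v - (2 - v) * Real.exp v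
  have hd : ∀ y : ℝ, HasDerivAt h (1 - (1 - y) * Real.exp y) y := by
    intro y
    have e1 : HasDerivAt (fun x : ℝ => 2 + x) 1 y := (hasDerivAt_id' y).const_add 2
    have e2 : HasDerivAt (fun x : ℝ => 2 - x) (-1) y := (hasDerivAt_id' y).const_sub 2
    refine (e1.sub (e2.mul (Real.hasDerivAt_exp y))).congr_deriv ?_
    ring
  have := monotoneOn_of_deriv_nonneg (convex_Ici (0:ℝ)) (f := h)
      (fun y hy => (hd y).continuousAt.continuousWithinAt)
      (fun y hy => (hd y).differentiableAt.differentiableWithinAt)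
      (by
        intro y hy
        rw [(hd y).deriv]
        have h1 := Real.add_one_le_exp (-y)
        have h2 : Real.exp (-y) * Real.exp y = 1 := by rw [← Real.exp_add]; simp
        nlinarith [Real.exp_pos y])
  have h3 := this (by simp) hv hv
  simp only [h] at h3
  simp at h3
  linarith

lemma tang_neg {r k : ℝ} (hr : 0 < r) (hr1 : r ≤ 1) (hk : 2 ≤ k) :
    (r - 1) * Real.log r ≤ k * (r - 1 - Real.log r) := by
  have h0 : 0 ≤ r - 1 - Real.log r := by linarith [Real.log_le_sub_one_of_pos hr]
  refine le_trans ?_ (mul_le_mul_of_nonneg_right hk h0)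
  have hl : Real.log r ≤ 0 := Real.log_nonpos hr.le hr1
  have h1 := exp_aux (v := -Real.log r) (by linarith)
  rw [Real.exp_neg, Real.exp_log hr] at h1
  have h2 : (2 - -Real.log r) ≤ (2 + -Real.log r) * r := by
    have := mul_le_mul_of_nonneg_right h1 hr.le
    rwa [mul_assoc, inv_mul_cancel₀ hr.ne', mul_one] at this
  nlinarith

lemma tang {r k : ℝ} (hr : 0 < r) (hk : 2 ≤ k) (hk2 : Real.log r ≤ k - 2) :
    (r - 1) * Real.log r ≤ k * (r - 1 - Real.log r) := by
  rcases le_total r 1 with hr1 | hr1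
  · exact tang_neg hr hr1 hk
  have h0 : 0 ≤ r - 1 - Real.log r := by linarith [Real.log_le_sub_one_of_pos hr]
  have : 2 + Real.log r ≤ k := by linarith
  refine le_trans ?_ (mul_le_mul_of_nonneg_right this h0)
  have h1 := Real.quadratic_le_exp_of_nonneg (Real.log_nonneg hr1)
  rw [Real.exp_log hr] at h1
  nlinarith

lemma exp_four {u : ℝ} (hu : 0 ≤ u) :
    1 + u + u ^ 2 / 2 + u ^ 3 / 6 + u ^ 4 / 24 ≤ Real.exp u := by
  have := Real.sum_le_exp_of_nonneg hu 5
  simp [Finset.sum_range_succ, Nat.factorial] at this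
  linarith

lemma tang_small {lam r : ℝ} (hl : 0 < lam) (hl4 : lam ≤ 1 / 4) (hr : 0 < r) (hr2 : r ≤ 1 / lam) :
    (r - 1) * Real.log r ≤ (2 - Real.log (2 * lam)) * (r - 1 - Real.log r) := by
  have l2 := Real.log_two_gt_d9
  have l2' := Real.log_two_lt_d9
  have hlog : Real.log (2 * lam) = Real.log 2 + Real.log lam := Real.log_mul (by norm_num) hl.ne'
  have hll : Real.log lam ≤ - (2 * Real.log 2) := by
    have := Real.log_le_log hl hl4
    have h4 : Real.log (1 / 4 : ℝ) = - (2 * Real.log 2) := by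
      rw [show (1 / 4 : ℝ) = (2 ^ 2)⁻¹ by norm_num, Real.log_inv, Real.log_pow]; norm_num
    linarith
  have hk : (2.69 : ℝ) ≤ 2 - Real.log (2 * lam) := by rw [hlog]; linarith
  rcases le_total r 1 with hr1 | hr1
  · exact tang_neg hr hr1 (by linarith)
  have h0 : 0 ≤ r - 1 - Real.log r := by linarith [Real.log_le_sub_one_of_pos hr]
  have hu : 0 ≤ Real.log r := Real.log_nonneg hr1
  have he := exp_four hu
  rw [Real.exp_log hr] at he
  have hrl : Real.log r ≤ - Real.log lam := by
    have := Real.log_le_log hr hr2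
    rwa [one_div, Real.log_inv] at this
  have hk2 : 1.3 + Real.log r ≤ 2 - Real.log (2 * lam) := by rw [hlog]; linarith
  set u := Real.log r
  rcases le_total u 1.39 with hc | hc
  · refine le_trans ?_ (mul_le_mul_of_nonneg_right hk h0)
    have : 0 ≤ (2.69 - u) * (r - (1 + u + u ^ 2 / 2 + u ^ 3 / 6 + u ^ 4 / 24)) :=
      mul_nonneg (by linarith) (by linarith)
    have h5 : 0 ≤ u ^ 2 * ((2.69 / 2 - 1) + u * (2.69 / 6 - 1 / 2) + u ^ 2 * (2.69/24 - 1/6) - u ^ 3/24) := by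
      apply mul_nonneg (by positivity)
      have : u ^ 2 ≤ 1.39 ^ 2 := by gcongr
      have : u ^ 3 ≤ 1.39 ^ 3 := by gcongr
      nlinarith
    nlinarith
  · refine le_trans ?_ (mul_le_mul_of_nonneg_right hk2 h0)
    have h5 : 0 ≤ u ^ 2 * (1.3 * (1 / 2 + u / 6 + u ^ 2 / 24) - 1) := by
      apply mul_nonneg (by positivity)
      nlinarith
    nlinarith

/-- tangent-line bound for 1/(c - log w) at b -/
lemma tang_div {w b c : ℝ} (hw : 0 < w) (hb : 0 < b) (hcw : Real.log w < c) (hcb : Real.log b < c)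
    (h : (w / b - 1) * Real.log (w / b) ≤ (c - Real.log b) * (w / b - 1 - Real.log (w / b))) :
    1 / (c - Real.log w) ≤ 1 / (c - Real.log b) + (w / b - 1) / (c - Real.log b) ^ 2 := by
  have e : c - Real.log w = (c - Real.log b) - Real.log (w / b) := by
    rw [Real.log_div hw.ne' hb.ne']; ring
  have hk : 0 < c - Real.log b := by linarith
  have hk2 : 0 < (c - Real.log b) - Real.log (w / b) := by rw [← e]; linarith
  rw [e]
  set k := c - Real.log b
  set r := w / b
  have : 1 / k + (r - 1) / k ^ 2 = (k + r - 1) / k ^ 2 := by field_simp; ring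
  rw [this, div_le_div_iff₀ hk2 (by positivity)]
  nlinarith

lemma c_bound {p lam : ℝ} (hl : 1 / 4 ≤ lam) (h1 : lam ≤ p) (h2 : lam ≤ 1 - p) :
    1 ≤ 2 * p * (1 - p) * (2 - Real.log (2 * lam)) := by
  have key : ∀ q : ℝ, lam ≤ q → q ≤ 1 / 2 → 1 ≤ 2 * q * (1 - q) * (2 - Real.log (2 * lam)) := by
    intro q hq1 hq2
    have hll : Real.log (2 * lam) ≤ Real.log (2 * q) := Real.log_le_log (by linarith) (by linarith)
    have hq : 0 < 2 * q * (1 - q) := by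
      apply mul_pos <;> linarith
    have h3 : (2 * (1 - 2 * q)) / (1 + 2 * q) ≤ - Real.log (2 * q) := by
      have := Real.le_log_one_add_of_nonneg (x := 1 / (2 * q) - 1) (by
        rw [sub_nonneg, le_div_iff₀ (by linarith)]; linarith)
      rw [← Real.log_inv]
      refine le_trans (le_of_eq ?_) (this.trans (le_of_eq ?_))
      · have : q ≠ 0 := by linarith
        have : 1 + 2 * q ≠ 0 := by linarith
        have : 1 / (2 * q) - 1 + 2 = (1 + 2 * q) / (2 * q) := by field_simp; ring
        rw [this]
        field_simp
      · congr 1; ring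
    have h4 : 1 ≤ 2 * q * (1 - q) * (2 + (2 * (1 - 2 * q)) / (1 + 2 * q)) := by
      have : 2 * q * (1 - q) * (2 + (2 * (1 - 2 * q)) / (1 + 2 * q)) =
        8 * q * (1 - q) / (1 + 2 * q) := by
        have : 1 + 2 * q ≠ 0 := by linarith
        field_simp; ring
      rw [this, le_div_iff₀ (by linarith)]
      nlinarith
    refine h4.trans (mul_le_mul_of_nonneg_left ?_ hq.le)
    linarith
  rcases le_total p (1 / 2) with h | h
  · exact key p h1 h
  · have := key (1 - p) h2 (by linarith)
    linarith [this, show 2 * (1 - p) * (1 - (1 - p)) * (2 - Real.log (2 * lam)) = 2 * p * (1 - p) * (2 - Real.log (2 * lam)) by ring]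

lemma two_point {p a b c : ℝ} (hp0 : 0 < p) (hp1 : p < 1) (ha : 1 < a) (hb : 0 < b)
    (hab : p * a + (1 - p) * b = 1) (hca : Real.log a < c) (hc : 1 ≤ 2 * p * (1 - p) * c) :
    p / (c - Real.log a) + (1 - p) / (c - Real.log b) ≤ 1 / c := by
  have hb1 : b < 1 := by nlinarith
  have hA : 0 < Real.log a := Real.log_pos ha
  have hB : Real.log b < 0 := Real.log_neg hb hb1
  have hc0 : 0 < c := by linarith
  obtain ⟨t, ht⟩ : ∃ t, t = p * (a - 1) := ⟨_, rfl⟩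
  have ht0 : 0 < t := by rw [ht]; apply mul_pos <;> linarith
  have hq : 0 < 1 - p := by linarith
  have hax : a = 1 + t / p := by rw [ht]; field_simp; ring
  have hbx : b = 1 + -(t / (1 - p)) := by
    have : (1 - p) * b = (1 - p) - t := by rw [ht]; linarith
    field_simp; linarith
  have ht1 : t < 1 - p := by nlinarith
  have hx : 0 < t / p := by positivity
  have hy : 0 < t / (1 - p) := by positivity
  have hy1 : t / (1 - p) < 1 := by rw [div_lt_one hq]; exact ht1
  have PA := pade (x := t / p) (by linarith)
  have PB := pade (x := -(t / (1 - p))) (by linarith)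
  rw [← hax] at PA
  rw [← hbx] at PB
  set A := Real.log a
  set B := Real.log b
  have hA' : (1 - p) * ((6 * p + 4 * t) * p / (t * (6 * p + t))) ≤ (1 - p) / A := by
    have : (6 * p + 4 * t) * p / (t * (6 * p + t)) ≤ 1 / A := by
      rw [div_le_div_iff₀ (by positivity) hA]
      have e : t / p * (6 + t / p) / (6 + 4 * (t / p)) = t * (6 * p + t) / ((6 * p + 4 * t) * p) := by
        have : 6 * p + 4 * t ≠ 0 := by positivity
        have e0 : 6 + 4 * (t / p) = (6 * p + 4 * t) / p := by field_simp
        rw [e0]; field_simp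
      rw [e, le_div_iff₀ (by positivity)] at PA
      linarith
    calc _ ≤ (1 - p) * (1 / A) := by gcongr
      _ = _ := by ring
  have h6 : 0 < 6 * (1 - p) - 4 * t := by linarith
  have h7 : 0 < 6 * (1 - p) - t := by linarith
  have hB' : p / (-B) ≤ p * ((6 * (1 - p) - 4 * t) * (1 - p) / (t * (6 * (1 - p) - t))) := by
    have : 1 / (-B) ≤ (6 * (1 - p) - 4 * t) * (1 - p) / (t * (6 * (1 - p) - t)) := by
      rw [div_le_div_iff₀ (by linarith) (by positivity)]
      have e : -(t / (1 - p)) * (6 + -(t / (1 - p))) / (6 + 4 * -(t / (1 - p)))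
          = -(t * (6 * (1 - p) - t) / ((6 * (1 - p) - 4 * t) * (1 - p))) := by
        have e0 : 6 + 4 * -(t / (1 - p)) = (6 * (1 - p) - 4 * t) / (1 - p) := by field_simp; ring
        rw [e0]; field_simp
        ring
      rw [e] at PB
      have PB' : t * (6 * (1 - p) - t) / ((6 * (1 - p) - 4 * t) * (1 - p)) ≤ -B := by linarith
      rw [div_le_iff₀ (by positivity)] at PB'
      linarith
    calc _ = p * (1 / (-B)) := by ring
      _ ≤ _ := by gcongr
  have hdiff : (1 - p) * ((6 * p + 4 * t) * p / (t * (6 * p + t))) -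
      p * ((6 * (1 - p) - 4 * t) * (1 - p) / (t * (6 * (1 - p) - t))) =
      18 * p * (1 - p) / ((6 * p + t) * (6 * (1 - p) - t)) := by
    have := h7.ne'
    have : 6 * p + t ≠ 0 := by positivity
    rw [mul_div_assoc', mul_div_assoc', div_sub_div _ _ (by positivity) (by positivity),
      div_eq_div_iff (by positivity) (by positivity)]
    ring
  have hge : 2 * p * (1 - p) ≤ 18 * p * (1 - p) / ((6 * p + t) * (6 * (1 - p) - t)) := by
    rw [le_div_iff₀ (by positivity)]
    have h9 : (6 * p + t) * (6 * (1 - p) - t) ≤ 9 := by nlinarith [sq_nonneg (6 * p + t - 3)]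
    have : 0 < 2 * p * (1 - p) := by positivity
    nlinarith
  have hG : 1 ≤ c * ((1 - p) / A - p / (-B)) := by
    have : 2 * p * (1 - p) ≤ (1 - p) / A - p / (-B) := by linarith
    nlinarith
  have hG2 : A * (-B) ≤ c * ((1 - p) * (-B) - p * A) := by
    have e : c * ((1 - p) * (-B) - p * A) = (c * ((1 - p) / A - p / (-B))) * (A * (-B)) := by
      have : A ≠ 0 := hA.ne'
      have : B ≠ 0 := hB.ne
      field_simp
      ring
    rw [e]
    have : 0 < A * (-B) := by apply mul_pos <;> linarith
    nlinarith
  rw [div_add_div _ _ (by linarith) (by linarith), div_le_div_iff₀ (by apply mul_pos <;> linarith) hc0]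
  nlinarith

lemma main_F {α : Type*} [Fintype α] [DecidableEq α] (p w : α → ℝ) {lam : ℝ} (hlam : 0 < lam)
    (hp : ∀ a, lam ≤ p a) (hsum : ∑ a, p a = 1) (hw : ∀ a, 0 < w a)
    (hpw : ∑ a, p a * w a = 1) :
    (∀ a, Real.log (w a) < 2 - Real.log (2 * lam)) ∧
    ∑ a, p a / ((2 - Real.log (2 * lam)) - Real.log (w a)) ≤ 1 / (2 - Real.log (2 * lam)) := by
  have hp0 : ∀ a, 0 < p a := fun a => hlam.trans_le (hp a)
  have hpwle : ∀ a, p a * w a ≤ 1 := by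
    intro a
    rw [← hpw]
    exact Finset.single_le_sum (f := fun a => p a * w a) (fun i _ => (mul_pos (hp0 i) (hw i)).le) (Finset.mem_univ a)
  have hwle : ∀ a, w a ≤ 1 / lam := by
    intro a
    rw [le_div_iff₀ hlam]
    nlinarith [hpwle a, hp a, hw a]
  have hlog : Real.log (2 * lam) = Real.log 2 + Real.log lam := Real.log_mul (by norm_num) hlam.ne'
  have l2 := Real.log_two_lt_d9
  have hlt : ∀ a, Real.log (w a) < 2 - Real.log (2 * lam) := by
    intro a
    have := Real.log_le_log (hw a) (hwle a)
    rw [one_div, Real.log_inv] at this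
    rw [hlog]; linarith
  refine ⟨hlt, ?_⟩
  have hple : ∀ a, p a ≤ 1 := by
    intro a
    rw [← hsum]
    exact Finset.single_le_sum (fun i _ => (hp0 i).le) (Finset.mem_univ a)
  have hne : Nonempty α := by
    by_contra h
    rw [not_nonempty_iff] at h
    simp at hsum
  obtain ⟨a0⟩ := hne
  have hlam1 : lam ≤ 1 := (hp a0).trans (hple a0)
  set c := 2 - Real.log (2 * lam) with hc
  have hc0 : 0 < c := by
    have : Real.log lam ≤ 0 := Real.log_nonpos hlam.le hlam1
    linarith
  -- case A
  have caseA : (∀ a, (w a - 1) * Real.log (w a) ≤ c * (w a - 1 - Real.log (w a))) →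
      ∑ a, p a / (c - Real.log (w a)) ≤ 1 / c := by
    intro h
    have h1 : ∀ a, p a / (c - Real.log (w a)) ≤ p a * (1 / c + (w a - 1) / c ^ 2) := by
      intro a
      have := tang_div (hw a) one_pos (hlt a) (by simpa using hc0) (by simpa using h a)
      simp only [Real.log_one, sub_zero, div_one] at this
      rw [div_eq_mul_one_div]
      exact mul_le_mul_of_nonneg_left this (hp0 a).le
    refine (Finset.sum_le_sum fun a _ => h1 a).trans (le_of_eq ?_)
    have : ∀ a, p a * (1 / c + (w a - 1) / c ^ 2) = p a * (1 / c) + (p a * w a - p a) * (1 / c ^ 2) := by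
      intro a; ring
    simp_rw [this]
    rw [Finset.sum_add_distrib, ← Finset.sum_mul, ← Finset.sum_mul, Finset.sum_sub_distrib, hsum, hpw]
    ring
  rcases le_total lam (1 / 4) with h4 | h4
  · exact caseA fun a => tang_small hlam h4 (hw a) (hwle a)
  by_cases hsub : ∀ a, p a = 1
  · -- all w = 1
    have hs : Subsingleton α := by
      refine ⟨fun x y => ?_⟩
      by_contra hxy
      have h2 : p x + p y ≤ ∑ a, p a := by
        rw [← Finset.sum_pair hxy]
        exact Finset.sum_le_univ_sum_of_nonneg (fun a => (hp0 a).le)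
      rw [hsub x, hsub y, hsum] at h2
      linarith
    apply caseA
    intro a
    have : w a = 1 := by
      rw [Fintype.sum_subsingleton _ a, hsub a] at hpw
      linarith
    simp [this]
  have hrest : ∀ a, p a + ∑ b ∈ Finset.univ.erase a, p b = 1 := by
    intro a; rw [← hsum]; exact Finset.add_sum_erase _ _ (Finset.mem_univ a)
  have hrestw : ∀ a, p a * w a + ∑ b ∈ Finset.univ.erase a, p b * w b = 1 := by
    intro a; rw [← hpw]
    exact Finset.add_sum_erase _ (fun b => p b * w b) (Finset.mem_univ a)
  -- at least two atoms
  obtain ⟨a1, ha1⟩ := not_forall.mp hsub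
  have hex : ∃ x y : α, x ≠ y := by
    by_contra hcon
    push Not at hcon
    have : ∑ b ∈ Finset.univ.erase a1, p b = 0 := by
      apply Finset.sum_eq_zero
      intro b hb
      exact absurd (hcon b a1) (Finset.ne_of_mem_erase hb)
    have h3 := hrest a1
    rw [this] at h3
    exact ha1 (by linarith)
  have hq : ∀ a, lam ≤ 1 - p a := by
    intro a
    obtain ⟨x, y, hxy⟩ := hex
    have : ∃ b, b ≠ a := by
      by_cases h : x = a
      · exact ⟨y, fun h' => hxy (h.trans h'.symm)⟩
      · exact ⟨x, h⟩
    obtain ⟨b, hb⟩ := this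
    have h5 : p b ≤ ∑ b ∈ Finset.univ.erase a, p b :=
      Finset.single_le_sum (fun i _ => (hp0 i).le) (Finset.mem_erase.mpr ⟨hb, Finset.mem_univ b⟩)
    linarith [hrest a, hp b]
  have hlamhalf : lam ≤ 1 / 2 := by linarith [hp a0, hq a0]
  have hc2 : 2 ≤ c := by
    have : Real.log (2 * lam) ≤ 0 := Real.log_nonpos (by linarith) (by linarith)
    linarith
  have hloginv : Real.log (1 / (2 * lam)) = c - 2 := by
    rw [one_div, Real.log_inv, hc]; ring
  by_cases hbig : ∀ a, w a ≤ 1 / (2 * lam)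
  · exact caseA fun a => tang (hw a) hc2 (by rw [← hloginv]; exact Real.log_le_log (hw a) (hbig a))
  push Not at hbig
  obtain ⟨v, hv⟩ := hbig
  have hv1 : 1 < w v := lt_of_le_of_lt (by rw [le_div_iff₀ (by linarith)]; linarith) hv
  have hs : 1 / 2 < p v * w v := by
    rw [div_lt_iff₀ (by linarith)] at hv
    nlinarith [hp v, hw v]
  have hqv : 0 < 1 - p v := by linarith [hq v]
  have hrpos : 0 < 1 - p v * w v := by
    obtain ⟨x, y, hxy⟩ := hex
    have : ∃ b, b ≠ v := by
      by_cases h : x = v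
      · exact ⟨y, fun h' => hxy (h.trans h'.symm)⟩
      · exact ⟨x, h⟩
    obtain ⟨b, hb⟩ := this
    have h5 : p b * w b ≤ ∑ b ∈ Finset.univ.erase v, p b * w b :=
      Finset.single_le_sum (f := fun b => p b * w b) (fun i _ => (mul_pos (hp0 i) (hw i)).le) (Finset.mem_erase.mpr ⟨hb, Finset.mem_univ b⟩)
    linarith [hrestw v, mul_pos (hp0 b) (hw b)]
  obtain ⟨b, hb⟩ : ∃ b, b = (1 - p v * w v) / (1 - p v) := ⟨_, rfl⟩
  have hb0 : 0 < b := by rw [hb]; positivity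
  have hbm : (1 - p v) * b = 1 - p v * w v := by rw [hb]; field_simp
  have hb1 : b < 1 := by nlinarith [hp0 v]
  have hlb : Real.log b < 0 := Real.log_neg hb0 hb1
  have hother : ∀ a ∈ Finset.univ.erase v, p a / (c - Real.log (w a)) ≤
      p a * (1 / (c - Real.log b) + (w a / b - 1) / (c - Real.log b) ^ 2) := by
    intro a ha
    have h5 : p a * w a ≤ ∑ b ∈ Finset.univ.erase v, p b * w b :=
      Finset.single_le_sum (f := fun b => p b * w b) (fun i _ => (mul_pos (hp0 i) (hw i)).le) ha
    have h6 : w a ≤ 1 / (2 * lam) := by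
      rw [le_div_iff₀ (by linarith)]
      nlinarith [hrestw v, hp a, hw a]
    have h7 := Real.log_le_log (hw a) h6
    rw [hloginv] at h7
    have := tang_div (hw a) hb0 (hlt a) (by linarith)
      (tang (div_pos (hw a) hb0) (by linarith) (by
        rw [Real.log_div (hw a).ne' hb0.ne']; linarith))
    rw [div_eq_mul_one_div]
    exact mul_le_mul_of_nonneg_left this (hp0 a).le
  rw [← Finset.add_sum_erase _ _ (Finset.mem_univ v)]
  have hsumo : ∑ a ∈ Finset.univ.erase v, p a / (c - Real.log (w a)) ≤ (1 - p v) / (c - Real.log b) := by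
    refine (Finset.sum_le_sum hother).trans (le_of_eq ?_)
    have : ∀ a, p a * (1 / (c - Real.log b) + (w a / b - 1) / (c - Real.log b) ^ 2) =
       p a * (1 / (c - Real.log b)) + (p a * w a * (1 / b) - p a) * (1 / (c - Real.log b) ^ 2) := by
      intro a; ring
    simp_rw [this]
    rw [Finset.sum_add_distrib, ← Finset.sum_mul, ← Finset.sum_mul, Finset.sum_sub_distrib, ← Finset.sum_mul]
    rw [show ∑ a ∈ Finset.univ.erase v, p a = 1 - p v by linarith [hrest v],
      show ∑ a ∈ Finset.univ.erase v, p a * w a = (1 - p v) * b by linarith [hrestw v]]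
    have e9 : (1 - p v) * b * (1 / b) = 1 - p v := by field_simp
    rw [e9]
    ring
  have h2p := two_point (hp0 v) (by linarith) hv1 hb0 (by linarith) (hlt v)
    (c_bound h4 (hp v) (hq v))
  linarith

end LS

namespace LS
open Finset

section
variable {α : Type*} [Fintype α] [DecidableEq α]

/-- entropy function x log x -/
noncomputable def Ph (x : ℝ) : ℝ := x * Real.log x

lemma lsi_pos (p g : α → ℝ) {lam : ℝ} (hlam : 0 < lam)
    (hp : ∀ a, lam ≤ p a) (hsum : ∑ a, p a = 1) (hg : ∀ a, 0 < g a) :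
    ∑ a, p a * Ph (g a ^ 2) - Ph (∑ a, p a * g a ^ 2) ≤
      (2 - Real.log (2 * lam)) * (∑ a, p a * g a ^ 2 - (∑ a, p a * g a) ^ 2) := by
  have hp0 : ∀ a, 0 < p a := fun a => hlam.trans_le (hp a)
  have hne : (univ : Finset α).Nonempty := by
    by_contra h
    rw [not_nonempty_iff_eq_empty] at h
    rw [h] at hsum
    simp at hsum
  obtain ⟨M, hM⟩ : ∃ M, M = ∑ a, p a * g a ^ 2 := ⟨_, rfl⟩
  have hM0 : 0 < M := by
    rw [hM]
    exact sum_pos (fun a _ => mul_pos (hp0 a) (pow_pos (hg a) 2)) hne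
  obtain ⟨hlt, hF⟩ := main_F p (fun a => g a ^ 2 / M) hlam hp hsum
    (fun a => div_pos (pow_pos (hg a) 2) hM0) (by
      simp_rw [mul_div_assoc']
      rw [← sum_div, ← hM, div_self hM0.ne'])
  rw [← hM]
  obtain ⟨c, hc⟩ : ∃ c, c = 2 - Real.log (2 * lam) := ⟨_, rfl⟩
  rw [← hc] at hlt hF ⊢
  have hent : ∑ a, p a * Ph (g a ^ 2) - Ph M = ∑ a, p a * g a ^ 2 * Real.log (g a ^ 2 / M) := by
    have : ∀ a, p a * g a ^ 2 * Real.log (g a ^ 2 / M) =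
        p a * Ph (g a ^ 2) - p a * g a ^ 2 * Real.log M := by
      intro a
      rw [Real.log_div (pow_pos (hg a) 2).ne' hM0.ne', Ph]; ring
    simp_rw [this]
    rw [sum_sub_distrib, ← sum_mul, ← hM, Ph]
  have hcs := sum_sq_le_sum_mul_sum_of_sq_eq_mul univ
    (r := fun a => p a * g a)
    (f := fun a => p a * g a ^ 2 * (c - Real.log (g a ^ 2 / M)))
    (g := fun a => p a / (c - Real.log (g a ^ 2 / M)))
    (fun a _ => mul_nonneg (mul_pos (hp0 a) (pow_pos (hg a) 2)).le (by linarith [hlt a]))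
    (fun a _ => div_nonneg (hp0 a).le (by linarith [hlt a]))
    (fun a _ => by
      have : c - Real.log (g a ^ 2 / M) ≠ 0 := by linarith [hlt a]
      field_simp)
  have hX : ∑ a, p a * g a ^ 2 * (c - Real.log (g a ^ 2 / M)) =
      c * M - (∑ a, p a * Ph (g a ^ 2) - Ph M) := by
    rw [hent]
    simp_rw [mul_sub]
    rw [sum_sub_distrib, ← sum_mul, ← hM]; ring
  have hX0 : 0 ≤ ∑ a, p a * g a ^ 2 * (c - Real.log (g a ^ 2 / M)) :=
    sum_nonneg (fun a _ => mul_nonneg (mul_pos (hp0 a) (pow_pos (hg a) 2)).le (by linarith [hlt a]))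
  have hc0 : 0 < c := by
    by_contra h
    have h1 : 1 / c ≤ 0 := one_div_nonpos.mpr (not_lt.mp h)
    have h2 : 0 < ∑ a, p a / (c - Real.log (g a ^ 2 / M)) :=
      sum_pos (fun a _ => div_pos (hp0 a) (by linarith [hlt a])) hne
    linarith
  have h3 : (∑ a, p a * g a) ^ 2 ≤ (∑ a, p a * g a ^ 2 * (c - Real.log (g a ^ 2 / M))) * (1 / c) :=
    hcs.trans (mul_le_mul_of_nonneg_left hF hX0)
  rw [hX, mul_one_div, le_div_iff₀ hc0] at h3
  linarith

lemma Ph_cont : Continuous Ph := Real.continuous_mul_log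

lemma lsi_one (p g : α → ℝ) {lam : ℝ} (hlam : 0 < lam)
    (hp : ∀ a, lam ≤ p a) (hsum : ∑ a, p a = 1) (hg : ∀ a, 0 ≤ g a) :
    ∑ a, p a * Ph (g a ^ 2) - Ph (∑ a, p a * g a ^ 2) ≤
      (2 - Real.log (2 * lam)) * (∑ a, p a * g a ^ 2 - (∑ a, p a * g a) ^ 2) := by
  have hP := Ph_cont
  have c1 : Continuous (fun e : ℝ => ∑ a, p a * Ph ((g a + e) ^ 2) - Ph (∑ a, p a * (g a + e) ^ 2)) := by
    fun_prop
  have c2 : Continuous (fun e : ℝ => (2 - Real.log (2 * lam)) *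
    (∑ a, p a * (g a + e) ^ 2 - (∑ a, p a * (g a + e)) ^ 2)) := by fun_prop
  have t1 := (c1.tendsto 0).mono_left (nhdsWithin_le_nhds (s := Set.Ioi 0))
  have t2 := (c2.tendsto 0).mono_left (nhdsWithin_le_nhds (s := Set.Ioi 0))
  have := le_of_tendsto_of_tendsto t1 t2 (by
    filter_upwards [self_mem_nhdsWithin] with e he
    exact lsi_pos p (fun a => g a + e) hlam hp hsum (fun a => add_pos_of_nonneg_of_pos (hg a) he))
  simpa using this

/-- expectation for the product weights -/
noncomputable def Ex (p : α → ℝ) (n : ℕ) (f : (Fin n → α) → ℝ) : ℝ :=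
  ∑ x : Fin n → α, (∏ i, p (x i)) * f x

lemma Ex_succ (p : α → ℝ) (n : ℕ) (f : (Fin (n + 1) → α) → ℝ) :
    Ex p (n + 1) f = ∑ a, p a * Ex p n (fun x => f (Fin.cons a x)) := by
  unfold Ex
  rw [← (Fin.consEquiv (fun _ => α)).sum_comp, Fintype.sum_prod_type]
  refine sum_congr rfl fun a _ => ?_
  rw [mul_sum]
  refine sum_congr rfl fun x _ => ?_
  simp [Fin.consEquiv, Fin.prod_univ_succ, mul_assoc]

lemma Ex_zero (p : α → ℝ) (f : (Fin 0 → α) → ℝ) : Ex p 0 f = f default := by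
  unfold Ex
  simp

lemma Ex_add (p : α → ℝ) (n : ℕ) (f g : (Fin n → α) → ℝ) :
    Ex p n (fun x => f x + g x) = Ex p n f + Ex p n g := by
  unfold Ex; simp_rw [mul_add]; exact sum_add_distrib

lemma Ex_sub (p : α → ℝ) (n : ℕ) (f g : (Fin n → α) → ℝ) :
    Ex p n (fun x => f x - g x) = Ex p n f - Ex p n g := by
  unfold Ex; simp_rw [mul_sub]; exact sum_sub_distrib _ _

lemma Ex_smul (p : α → ℝ) (n : ℕ) (c : ℝ) (f : (Fin n → α) → ℝ) :
    Ex p n (fun x => c * f x) = c * Ex p n f := by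
  unfold Ex; rw [mul_sum]; exact sum_congr rfl fun x _ => by ring

lemma Ex_sum {β : Type*} (s : Finset β) (p : α → ℝ) (n : ℕ) (f : β → (Fin n → α) → ℝ) :
    Ex p n (fun x => ∑ b ∈ s, f b x) = ∑ b ∈ s, Ex p n (f b) := by
  unfold Ex; simp_rw [mul_sum]; exact sum_comm

lemma Ex_nonneg (p : α → ℝ) (hp : ∀ a, 0 < p a) (n : ℕ) (f : (Fin n → α) → ℝ) (hf : ∀ x, 0 ≤ f x) :
    0 ≤ Ex p n f :=
  sum_nonneg fun x _ => mul_nonneg (prod_nonneg fun i _ => (hp _).le) (hf x)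

lemma Ex_one (p : α → ℝ) (hsum : ∑ a, p a = 1) (n : ℕ) : Ex p n (fun _ => 1) = 1 := by
  induction n with
  | zero => rw [Ex_zero]
  | succ n ih => rw [Ex_succ, ih]; simpa using hsum

lemma Ex_cs (p : α → ℝ) (hp : ∀ a, 0 < p a) (n : ℕ) (f g : (Fin n → α) → ℝ) :
    (Ex p n (fun x => f x * g x)) ^ 2 ≤ Ex p n (fun x => f x ^ 2) * Ex p n (fun x => g x ^ 2) := by
  have hW : ∀ x : Fin n → α, 0 ≤ ∏ i, p (x i) := fun x => prod_nonneg fun i _ => (hp _).le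
  exact sum_sq_le_sum_mul_sum_of_sq_eq_mul univ
    (fun x _ => mul_nonneg (hW x) (sq_nonneg _)) (fun x _ => mul_nonneg (hW x) (sq_nonneg _))
    (fun x _ => by ring)

/-- Dirichlet form -/
noncomputable def En (p : α → ℝ) : (n : ℕ) → ((Fin n → α) → ℝ) → ℝ
  | 0, _ => 0
  | n + 1, f => ∑ a, p a * En p n (fun x => f (Fin.cons a x)) +
      (∑ a, p a * Ex p n (fun x => f (Fin.cons a x) ^ 2)
        - Ex p n (fun x => (∑ a, p a * f (Fin.cons a x)) ^ 2))

lemma lsi (p : α → ℝ) {lam : ℝ} (hlam : 0 < lam)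
    (hp : ∀ a, lam ≤ p a) (hsum : ∑ a, p a = 1) (hc : 0 ≤ 2 - Real.log (2 * lam))
    (n : ℕ) (f : (Fin n → α) → ℝ) :
    Ex p n (fun x => Ph (f x ^ 2)) - Ph (Ex p n (fun x => f x ^ 2)) ≤
      (2 - Real.log (2 * lam)) * En p n f := by
  have hp0 : ∀ a, 0 < p a := fun a => hlam.trans_le (hp a)
  induction n with
  | zero => simp [Ex_zero, En]
  | succ n ih =>
    rw [Ex_succ, Ex_succ, En]
    obtain ⟨g, hg⟩ : ∃ g : α → ℝ, g = fun a => Real.sqrt (Ex p n (fun x => f (Fin.cons a x) ^ 2)) :=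
      ⟨_, rfl⟩
    have hnn : ∀ a, 0 ≤ Ex p n (fun x => f (Fin.cons a x) ^ 2) :=
      fun a => Ex_nonneg p hp0 n _ (fun x => sq_nonneg _)
    have hg2 : ∀ a, g a ^ 2 = Ex p n (fun x => f (Fin.cons a x) ^ 2) := by
      intro a; rw [hg]; exact Real.sq_sqrt (hnn a)
    have hg0 : ∀ a, 0 ≤ g a := by intro a; rw [hg]; exact Real.sqrt_nonneg _
    have h1 := lsi_one p g hlam hp hsum hg0
    simp_rw [hg2] at h1
    have h2 : ∑ a, p a * (Ex p n (fun x => Ph (f (Fin.cons a x) ^ 2)) - Ph (Ex p n (fun x => f (Fin.cons a x) ^ 2)))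
      ≤ ∑ a, p a * ((2 - Real.log (2 * lam)) * En p n (fun x => f (Fin.cons a x))) :=
      sum_le_sum fun a _ => mul_le_mul_of_nonneg_left (ih _) (hp0 a).le
    have h3 : ∑ a, p a * ((2 - Real.log (2 * lam)) * En p n (fun x => f (Fin.cons a x))) =
        (2 - Real.log (2 * lam)) * ∑ a, p a * En p n (fun x => f (Fin.cons a x)) := by
      rw [mul_sum]; exact sum_congr rfl fun a _ => by ring
    simp_rw [mul_sub] at h2
    rw [sum_sub_distrib] at h2
    have h4 : Ex p n (fun x => (∑ a, p a * f (Fin.cons a x)) ^ 2) ≤ (∑ a, p a * g a) ^ 2 := by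
      simp_rw [sq (∑ a, _), sum_mul_sum]
      rw [Ex_sum]
      refine sum_le_sum fun a _ => ?_
      rw [Ex_sum]
      refine sum_le_sum fun b _ => ?_
      have e : (fun x : Fin n → α => p a * f (Fin.cons a x) * (p b * f (Fin.cons b x))) =
        fun x => (p a * p b) * (f (Fin.cons a x) * f (Fin.cons b x)) := by funext x; ring
      rw [e, Ex_smul]
      have h5 : Ex p n (fun x => f (Fin.cons a x) * f (Fin.cons b x)) ≤ g a * g b := by
        apply le_of_sq_le_sq _ (mul_nonneg (hg0 a) (hg0 b))
        rw [mul_pow, hg2, hg2]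
        exact Ex_cs p hp0 n _ _
      calc _ ≤ p a * p b * (g a * g b) := mul_le_mul_of_nonneg_left h5 (mul_pos (hp0 a) (hp0 b)).le
        _ = _ := by ring
    have h6 := mul_le_mul_of_nonneg_left h4 hc
    simp only [mul_sub, mul_add] at *
    linarith

lemma Ex_quad (p : α → ℝ) (n : ℕ) (g h : (Fin n → α) → ℝ) (t : ℝ) :
    Ex p n (fun x => (g x + t * h x) ^ 2) = Ex p n (fun x => g x ^ 2) +
      t * (2 * Ex p n (fun x => g x * h x)) + t ^ 2 * Ex p n (fun x => h x ^ 2) := by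
  rw [← Ex_smul, ← Ex_smul, ← Ex_smul, ← Ex_add, ← Ex_add]
  congr 1; funext x; ring

lemma En_quad (p : α → ℝ) (n : ℕ) : ∀ (g h : (Fin n → α) → ℝ), ∃ B : ℝ, ∀ t : ℝ,
    En p n (fun x => g x + t * h x) = En p n g + t * B + t ^ 2 * En p n h := by
  induction n with
  | zero => intro g h; exact ⟨0, fun t => by simp [En]⟩
  | succ n ih =>
    intro g h
    choose B hB using fun a => ih (fun x => g (Fin.cons a x)) (fun x => h (Fin.cons a x))
    refine ⟨∑ a, p a * B a + (∑ a, p a * (2 * Ex p n (fun x => g (Fin.cons a x) * h (Fin.cons a x)))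
      - 2 * Ex p n (fun x => (∑ a, p a * g (Fin.cons a x)) * (∑ a, p a * h (Fin.cons a x)))), fun t => ?_⟩
    simp only [En]
    have e1 : ∀ x, ∑ a, p a * (g (Fin.cons a x) + t * h (Fin.cons a x)) =
      (∑ a, p a * g (Fin.cons a x)) + t * ∑ a, p a * h (Fin.cons a x) := by
      intro x
      rw [mul_sum, ← sum_add_distrib]
      exact sum_congr rfl fun a _ => by ring
    simp_rw [e1, hB, Ex_quad]
    simp_rw [mul_add, sum_add_distrib]
    have e2 : ∀ (s : ℝ) (F : α → ℝ), ∑ a, p a * (s * F a) = s * ∑ a, p a * F a := by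
      intro s F
      rw [mul_sum]
      exact sum_congr rfl fun a _ => by ring
    simp_rw [e2]
    ring

/-- polynomials of degree `< d` in the centred variable `z` -/
def Q (z : α → ℝ) : (n : ℕ) → ℕ → ((Fin n → α) → ℝ) → Prop
  | 0, d, f => d = 0 → f = 0
  | n + 1, d, f => ∃ g h : (Fin n → α) → ℝ,
      (∀ a x, f (Fin.cons a x) = g x + z a * h x) ∧ Q z n d g ∧ Q z n (d - 1) h

lemma Q_zero_deg (z : α → ℝ) (n : ℕ) : ∀ f, Q z n 0 f → f = 0 := by
  induction n with
  | zero => intro f hf; exact hf rfl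
  | succ n ih =>
    rintro f ⟨g, h, hf, hg, hh⟩
    funext x
    rw [← Fin.cons_self_tail x, hf, ih g hg, ih h hh]
    simp

lemma Q_add (z : α → ℝ) (n : ℕ) : ∀ d f g, Q z n d f → Q z n d g → Q z n d (f + g) := by
  induction n with
  | zero => intro d f g hf hg hd; rw [hf hd, hg hd]; simp
  | succ n ih =>
    rintro d f f' ⟨g, h, hf, hg, hh⟩ ⟨g', h', hf', hg', hh'⟩
    refine ⟨g + g', h + h', fun a x => ?_, ih _ _ _ hg hg', ih _ _ _ hh hh'⟩
    simp only [Pi.add_apply, hf, hf']; ring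

lemma Q_smul (z : α → ℝ) (n : ℕ) : ∀ d (c : ℝ) f, Q z n d f → Q z n d (c • f) := by
  induction n with
  | zero => intro d c f hf hd; rw [hf hd]; simp
  | succ n ih =>
    rintro d c f ⟨g, h, hf, hg, hh⟩
    refine ⟨c • g, c • h, fun a x => ?_, ih _ _ _ hg, ih _ _ _ hh⟩
    simp only [Pi.smul_apply, smul_eq_mul, hf]; ring

lemma Q_zero (z : α → ℝ) (n : ℕ) : ∀ d, Q z n d 0 := by
  induction n with
  | zero => intro d hd; rfl
  | succ n ih =>
    intro d
    exact ⟨0, 0, fun a x => by simp, ih _, ih _⟩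

lemma Q_mono (z : α → ℝ) (n : ℕ) : ∀ d d' f, d ≤ d' → Q z n d f → Q z n d' f := by
  induction n with
  | zero => intro d d' f hd hf hd'; exact hf (by omega)
  | succ n ih =>
    rintro d d' f hd ⟨g, h, hf, hg, hh⟩
    exact ⟨g, h, hf, ih _ _ _ hd hg, ih _ _ _ (by omega) hh⟩

lemma Q_sum {β : Type*} (s : Finset β) (z : α → ℝ) (n d : ℕ) (f : β → (Fin n → α) → ℝ)
    (h : ∀ b ∈ s, Q z n d (f b)) : Q z n d (∑ b ∈ s, f b) := by
  classical
  induction s using Finset.induction_on with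
  | empty => simpa using Q_zero z n d
  | insert b s hb ih =>
    rw [sum_insert hb]
    exact Q_add _ _ _ _ _ (h b (by simp)) (ih fun b' hb' => h b' (by simp [hb']))

lemma Q_mono_S (z v : α → ℝ) (m : ℝ) (hv : ∀ a, v a = z a + m) (n : ℕ) :
    ∀ S : Finset (Fin n), Q z n (S.card + 1) (fun x => ∏ i, if i ∈ S then v (x i) else 1) := by
  induction n with
  | zero => intro S hS; omega
  | succ n ih =>
    intro S
    have hS' := ih (univ.filter fun i : Fin n => i.succ ∈ S)
    have hcard : S.card = (if (0 : Fin (n+1)) ∈ S then 1 else 0) + (univ.filter fun i : Fin n => i.succ ∈ S).card := by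
      have := Fin.card_filter_univ_succ (fun i : Fin (n+1) => i ∈ S)
      simp only [filter_univ_mem] at this
      rw [this]
      split_ifs <;> simp [add_comm, Function.comp_def]
    obtain ⟨F, hF⟩ : ∃ F : (Fin n → α) → ℝ, F = fun x => ∏ i, if i ∈ (univ.filter fun i : Fin n => i.succ ∈ S) then v (x i) else 1 := ⟨_, rfl⟩
    rw [← hF] at hS'
    have hprod : ∀ a x, (∏ i : Fin (n+1), if i ∈ S then v ((Fin.cons a x : Fin (n+1) → α) i) else 1) =
      (if (0 : Fin (n+1)) ∈ S then v a else 1) * F x := by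
      intro a x
      rw [Fin.prod_univ_succ, hF]
      simp
    by_cases h0 : (0 : Fin (n+1)) ∈ S
    · simp only [h0, if_true] at hprod hcard
      refine ⟨m • F, F, fun a x => ?_, ?_, ?_⟩
      · refine (hprod a x).trans ?_
        rw [hv]; simp only [Pi.smul_apply, smul_eq_mul]; ring
      · exact Q_smul _ _ _ _ _ (Q_mono _ _ _ _ _ (by omega) hS')
      · exact Q_mono _ _ _ _ _ (by omega) hS'
    · simp only [h0, if_false] at hprod hcard
      refine ⟨F, 0, fun a x => ?_, ?_, Q_zero _ _ _⟩
      · simp [hprod]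
      · exact Q_mono _ _ _ _ _ (by omega) hS'

lemma En_zero (p : α → ℝ) (n : ℕ) : En p n (fun _ => 0) = 0 := by
  obtain ⟨B, hB⟩ := En_quad p n (fun _ => 0) (fun _ => 0)
  have h1 := hB 1
  have h2 := hB (-1)
  simp at h1 h2
  linarith

lemma En_le (p z : α → ℝ) (hp0 : ∀ a, 0 < p a) (hsum : ∑ a, p a = 1) (hz : ∑ a, p a * z a = 0) (n : ℕ) :
    ∀ (d : ℕ) f, Q z n d f → En p n f ≤ ((d - 1 : ℕ) : ℝ) * Ex p n (fun x => f x ^ 2) := by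
  induction n with
  | zero =>
    intro d f _
    simp only [En]
    exact mul_nonneg (Nat.cast_nonneg _) (Ex_nonneg p hp0 _ _ fun x => sq_nonneg _)
  | succ n ih =>
    rintro d f ⟨g, h, hf, hg, hh⟩
    rw [Ex_succ]
    simp only [En, hf]
    obtain ⟨B, hB⟩ := En_quad p n g h
    obtain ⟨s, hs⟩ : ∃ s, s = ∑ a, p a * z a ^ 2 := ⟨_, rfl⟩
    have hs0 : 0 ≤ s := by rw [hs]; exact sum_nonneg fun a _ => mul_nonneg (hp0 a).le (sq_nonneg _)
    have e0 : ∀ x, ∑ a, p a * (g x + z a * h x) = g x := by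
      intro x
      have : ∀ a, p a * (g x + z a * h x) = p a * g x + p a * z a * h x := fun a => by ring
      simp_rw [this]
      rw [sum_add_distrib, ← sum_mul, ← sum_mul, hsum, hz]; ring
    have e1 : ∀ A B C : ℝ, ∑ a, p a * (A + z a * B + z a ^ 2 * C) = A + s * C := by
      intro A B C
      have : ∀ a, p a * (A + z a * B + z a ^ 2 * C) = p a * A + p a * z a * B + p a * z a ^ 2 * C :=
        fun a => by ring
      simp_rw [this]
      rw [sum_add_distrib, sum_add_distrib, ← sum_mul, ← sum_mul, ← sum_mul, hsum, hz, ← hs]; ring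
    simp_rw [e0, hB, Ex_quad, e1]
    have hgI := ih d g hg
    have hhI := ih (d - 1) h hh
    have hG : 0 ≤ Ex p n (fun x => g x ^ 2) := Ex_nonneg p hp0 _ _ fun x => sq_nonneg _
    have hH : 0 ≤ Ex p n (fun x => h x ^ 2) := Ex_nonneg p hp0 _ _ fun x => sq_nonneg _
    rcases Nat.lt_or_ge d 2 with hd | hd
    · have hd1 : d - 1 = 0 := by omega
      rw [hd1] at hh
      have hh0 := Q_zero_deg z n h hh
      rw [hd1] at hgI ⊢
      subst hh0
      have : En p n (0 : (Fin n → α) → ℝ) = 0 := En_zero p n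
      have h2 : Ex p n (fun x => (0 : (Fin n → α) → ℝ) x ^ 2) = 0 := by simp [Ex]
      rw [this, h2]
      simp at hgI ⊢
      linarith
    · obtain ⟨k, rfl⟩ : ∃ k, d = k + 2 := ⟨d - 2, by omega⟩
      have e3 : k + 2 - 1 - 1 = k := by omega
      have e4 : k + 2 - 1 = k + 1 := by omega
      rw [e3] at hhI
      rw [e4] at hgI ⊢
      have := mul_le_mul_of_nonneg_left hhI hs0
      push_cast at *
      nlinarith

lemma norm_bound (p : α → ℝ) (hp0 : ∀ a, 0 < p a) (n : ℕ) (f : (Fin n → α) → ℝ) (K : ℝ)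
    (hM : 0 < Ex p n (fun x => f x ^ 2))
    (hent : Ex p n (fun x => Ph (f x ^ 2)) - Ph (Ex p n (fun x => f x ^ 2)) ≤ K * Ex p n (fun x => f x ^ 2)) :
    Ex p n (fun x => f x ^ 2) ≤ (Ex p n (fun x => |f x|)) ^ 2 * Real.exp K := by
  obtain ⟨M, hMd⟩ : ∃ M, M = Ex p n (fun x => f x ^ 2) := ⟨_, rfl⟩
  obtain ⟨s, hs⟩ : ∃ s, s = Ex p n (fun x => |f x|) := ⟨_, rfl⟩
  rw [← hMd, ← hs]
  rw [← hMd] at hent hM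
  have hW : ∀ x : Fin n → α, 0 < ∏ i, p (x i) := fun x => prod_pos fun i _ => hp0 _
  have hs0 : 0 < s := by
    have h0 : 0 ≤ s := by rw [hs]; exact Ex_nonneg p hp0 _ _ fun x => abs_nonneg _
    rcases h0.lt_or_eq with h | h
    · exact h
    · exfalso
      rw [hs, Ex, eq_comm, sum_eq_zero_iff_of_nonneg (fun x _ => mul_nonneg (hW x).le (abs_nonneg _))] at h
      have : M = 0 := by
        rw [hMd, Ex]
        apply sum_eq_zero
        intro x hx
        have := h x hx
        rcases mul_eq_zero.mp this with h1 | h1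
        · exact absurd h1 (hW x).ne'
        · rw [abs_eq_zero.mp h1]; simp
      linarith
  have key : ∀ x, 2 * f x ^ 2 * (Real.log M - Real.log s) - Ph (f x ^ 2) ≤ 2 * (M / s * |f x| - f x ^ 2) := by
    intro x
    by_cases h0 : f x = 0
    · simp [h0, Ph]
    have ha : 0 < |f x| := abs_pos.mpr h0
    have h1 := Real.log_le_sub_one_of_pos (x := M / (s * |f x|)) (by positivity)
    rw [Real.log_div hM.ne' (by positivity), Real.log_mul hs0.ne' ha.ne'] at h1
    have h2 : Ph (f x ^ 2) = f x ^ 2 * (2 * Real.log |f x|) := by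
      rw [Ph, Real.log_pow, Real.log_abs]; norm_num
    have h3 : f x ^ 2 * (M / (s * |f x|)) = M / s * |f x| := by
      rw [← sq_abs]; field_simp
    rw [h2]
    have := mul_le_mul_of_nonneg_left h1 (sq_nonneg (f x))
    nlinarith
  have h4 : Ex p n (fun x => 2 * f x ^ 2 * (Real.log M - Real.log s) - Ph (f x ^ 2)) ≤
      Ex p n (fun x => 2 * (M / s * |f x| - f x ^ 2)) :=
    sum_le_sum fun x _ => mul_le_mul_of_nonneg_left (key x) (hW x).le
  have e : (fun x => 2 * f x ^ 2 * (Real.log M - Real.log s) - Ph (f x ^ 2)) =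
    fun x => (2 * (Real.log M - Real.log s)) * f x ^ 2 - Ph (f x ^ 2) := by funext x; ring
  rw [e, Ex_sub, Ex_smul, Ex_smul, Ex_sub, Ex_smul, ← hMd, ← hs, div_mul_cancel₀ _ hs0.ne', sub_self] at h4
  have h5 : M * (Real.log M - 2 * Real.log s) ≤ M * K := by
    rw [Ph] at hent
    linarith
  have h6 := le_of_mul_le_mul_left h5 hM
  calc M = Real.exp (Real.log M) := (Real.exp_log hM).symm
    _ ≤ Real.exp (2 * Real.log s + K) := Real.exp_le_exp.mpr (by linarith)
    _ = s ^ 2 * Real.exp K := by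
      rw [Real.exp_add, two_mul, Real.exp_add, Real.exp_log hs0]; ring

lemma prob_bound (p : α → ℝ) (hp0 : ∀ a, 0 < p a) (hsum : ∑ a, p a = 1) (n : ℕ) (f : (Fin n → α) → ℝ) (K : ℝ)
    (hM : 0 < Ex p n (fun x => f x ^ 2)) (h0 : Ex p n f = 0)
    (hb : Ex p n (fun x => f x ^ 2) ≤ (Ex p n (fun x => |f x|)) ^ 2 * Real.exp K) :
    1 / 4 * Real.exp (-K) ≤ Ex p n (fun x => if 0 ≤ f x then 1 else 0) := by
  have h1 : Ex p n (fun x => |f x|) = 2 * Ex p n (fun x => (if 0 ≤ f x then 1 else 0) * f x) := by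
    have : (fun x => |f x|) = fun x => 2 * ((if 0 ≤ f x then 1 else 0) * f x) - f x := by
      funext x
      split_ifs with h
      · rw [abs_of_nonneg h]; ring
      · rw [abs_of_neg (not_le.mp h)]; ring
    rw [this, Ex_sub, h0, Ex_smul]; ring
  have h2 := Ex_cs p hp0 n (fun x => if 0 ≤ f x then 1 else 0) f
  have e : (fun x => (if 0 ≤ f x then (1:ℝ) else 0) ^ 2) = fun x => if 0 ≤ f x then 1 else 0 := by
    funext x; split_ifs <;> simp
  rw [e] at h2
  rw [h1, mul_pow] at hb
  have h3 : Ex p n (fun x => f x ^ 2) * 1 ≤ Ex p n (fun x => f x ^ 2) *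
    (4 * Ex p n (fun x => if 0 ≤ f x then 1 else 0) * Real.exp K) := by
    have := mul_le_mul_of_nonneg_right h2 (Real.exp_pos K).le
    linarith
  have h4 := le_of_mul_le_mul_left h3 hM
  rw [Real.exp_neg, ← div_eq_mul_inv, div_le_iff₀ (Real.exp_pos K)]
  linarith

lemma final (p v : α → ℝ) {lam : ℝ} (hlam : 0 < lam)
    (hp : ∀ a, lam ≤ p a) (hsum : ∑ a, p a = 1) (n d : ℕ) (coeff : Finset (Fin n) → ℝ)
    (hdeg : ∀ S : Finset (Fin n), d < S.card → coeff S = 0) :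
    (1 / 4) * (2 * lam / Real.exp 1 ^ 2) ^ d ≤
      Ex p n (fun x => if Ex p n (fun x => mlEval coeff (fun i => v (x i))) ≤
        mlEval coeff (fun i => v (x i)) then 1 else 0) := by
  have hp0 : ∀ a, 0 < p a := fun a => hlam.trans_le (hp a)
  have hlam1 : lam ≤ 1 := by
    have hne : Nonempty α := by
      by_contra h
      rw [not_nonempty_iff] at h
      simp at hsum
    obtain ⟨a0⟩ := hne
    refine (hp a0).trans ?_
    rw [← hsum]
    exact single_le_sum (fun i _ => (hp0 i).le) (mem_univ a0)
  have hc : 0 ≤ 2 - Real.log (2 * lam) := by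
    have := Real.log_le_sub_one_of_pos (x := 2 * lam) (by linarith)
    linarith
  obtain ⟨m, hm⟩ : ∃ m, m = ∑ a, p a * v a := ⟨_, rfl⟩
  obtain ⟨z, hz⟩ : ∃ z : α → ℝ, z = fun a => v a - m := ⟨_, rfl⟩
  have hzm : ∑ a, p a * z a = 0 := by
    rw [hz]
    simp_rw [mul_sub]
    rw [sum_sub_distrib, ← sum_mul, hsum, ← hm]; ring
  have hvz : ∀ a, v a = z a + m := fun a => by rw [hz]; ring
  obtain ⟨F, hF⟩ : ∃ F : (Fin n → α) → ℝ, F = fun x => mlEval coeff (fun i => v (x i)) := ⟨_, rfl⟩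
  have hFx : ∀ x, mlEval coeff (fun i => v (x i)) = F x := fun x => by rw [hF]
  simp_rw [hFx]
  obtain ⟨μ, hμ⟩ : ∃ μ, μ = Ex p n (fun x => F x) := ⟨_, rfl⟩
  rw [← hμ]
  have hQF : Q z n (d + 1) F := by
    have e : F = ∑ S : Finset (Fin n), coeff S • (fun x : Fin n → α => ∏ i, if i ∈ S then v (x i) else 1) := by
      rw [hF]
      funext x
      simp [mlEval, Finset.sum_apply, Finset.prod_ite_mem]
    rw [e]
    apply Q_sum
    intro S _
    by_cases hS : d < S.card
    · rw [hdeg S hS, zero_smul]; exact Q_zero _ _ _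
    · exact Q_smul _ _ _ _ _ (Q_mono _ _ _ _ _ (by omega) (Q_mono_S z v m hvz n S))
  have hQ1 : Q z n (d + 1) (fun _ => 1) := by
    have := Q_mono_S z v m hvz n ∅
    simp at this
    exact Q_mono _ _ _ _ _ (by omega) this
  obtain ⟨f, hf⟩ : ∃ f : (Fin n → α) → ℝ, f = F + (-μ) • (fun _ => 1) := ⟨_, rfl⟩
  have hQf : Q z n (d + 1) f := by rw [hf]; exact Q_add _ _ _ _ _ hQF (Q_smul _ _ _ _ _ hQ1)
  have hfx : ∀ x, f x = F x - μ := fun x => by rw [hf]; simp; ring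
  have hf0 : Ex p n f = 0 := by
    have : f = fun x => F x - μ * 1 := by funext x; rw [hfx]; ring
    rw [this, Ex_sub, Ex_smul, Ex_one p hsum, ← hμ]; ring
  have hEn := En_le p z hp0 hsum hzm n (d + 1) f hQf
  have hlsi := lsi p hlam hp hsum hc n f
  have hiff : ∀ x, μ ≤ F x ↔ 0 ≤ f x := fun x => by rw [hfx]; exact sub_nonneg.symm
  simp_rw [hiff]
  have hconst : (2 * lam / Real.exp 1 ^ 2) ^ d = Real.exp (-((2 - Real.log (2 * lam)) * d)) := by
    have : 2 * lam / Real.exp 1 ^ 2 = Real.exp (-(2 - Real.log (2 * lam))) := by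
      rw [neg_sub, Real.exp_sub, Real.exp_log (by linarith), ← Real.exp_nat_mul]; norm_num
    rw [this, ← Real.exp_nat_mul]; congr 1; ring
  rw [hconst]
  have hMn : 0 ≤ Ex p n (fun x => f x ^ 2) := Ex_nonneg p hp0 _ _ fun x => sq_nonneg _
  rcases hMn.lt_or_eq with hM | hM
  · apply prob_bound p hp0 hsum n f _ hM hf0
    apply norm_bound p hp0 n f _ hM
    refine hlsi.trans ?_
    have := mul_le_mul_of_nonneg_left hEn hc
    simp only [Nat.add_sub_cancel] at this
    linarith
  · have hall : ∀ x, f x = 0 := by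
      have hW : ∀ x : Fin n → α, 0 < ∏ i, p (x i) := fun x => prod_pos fun i _ => hp0 _
      rw [Ex, eq_comm, sum_eq_zero_iff_of_nonneg (fun x _ => mul_nonneg (hW x).le (sq_nonneg _))] at hM
      intro x
      rcases mul_eq_zero.mp (hM x (mem_univ x)) with h1 | h1
      · exact absurd h1 (hW x).ne'
      · exact pow_eq_zero_iff (by norm_num) |>.mp h1
    simp only [hall, le_refl, if_true]
    rw [Ex_one p hsum]
    have : Real.exp (-((2 - Real.log (2 * lam)) * d)) ≤ 1 := by
      rw [Real.exp_le_one_iff]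
      have : 0 ≤ (2 - Real.log (2 * lam)) * d := by positivity
      linarith
    linarith

end
end LS

theorem stmt9 {n d : ℕ} (μ : Measure ℝ) [IsProbabilityMeasure μ]
    (supp : Finset ℝ) (hsupp : μ ↑supp = 1)
    (lam : ℝ) (hlam : 0 < lam)
    (hmin : ∀ v ∈ supp, μ {v} ≠ 0 → lam ≤ (μ {v}).toReal)
    (coeff : Finset (Fin n) → ℝ)
    (hdeg : ∀ S : Finset (Fin n), d < S.card → coeff S = 0) :
    (1 / 4) * (2 * lam / Real.exp 1 ^ 2) ^ d ≤
      ((Measure.pi fun _ : Fin n => μ)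
        {y | (∫ z, mlEval coeff z ∂(Measure.pi fun _ : Fin n => μ)) ≤
          mlEval coeff y}).toReal := by
  classical
  let T : Finset ℝ := supp.filter (fun v => μ {v} ≠ 0)
  let p : T → ℝ := fun a => μ.real {(a : ℝ)}
  have hT : μ.real (T : Set ℝ) = 1 := by
    have h1 : μ.real (supp : Set ℝ) = 1 := by simp [measureReal_def, hsupp]
    rw [← sum_measureReal_singleton] at h1 ⊢
    rw [← h1, Finset.sum_filter_of_ne]
    intro x _ hx h
    exact hx (by simp [measureReal_def, h])
  have hsum : ∑ a, p a = 1 := by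
    rw [← hT, ← sum_measureReal_singleton]
    exact Finset.sum_coe_sort T (fun v => μ.real {v})
  have hp : ∀ a, lam ≤ p a := by
    rintro ⟨a, ha⟩
    have := Finset.mem_filter.mp ha
    exact hmin a this.1 this.2
  let ν := Measure.pi fun _ : Fin n => μ
  let e : (Fin n → T) ↪ (Fin n → ℝ) := ⟨fun x i => (x i : ℝ), fun x y h => by
    funext i; exact Subtype.ext (congrFun h i)⟩
  let R : Finset (Fin n → ℝ) := Finset.univ.map e
  have hsing : ∀ x : Fin n → T, ν.real {e x} = ∏ i, p (x i) := by
    intro x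
    simp only [measureReal_def, ν, Measure.pi_singleton, ENNReal.toReal_prod]
    rfl
  have hR : ν.real (R : Set (Fin n → ℝ)) = 1 := by
    rw [← sum_measureReal_singleton, Finset.sum_map]
    simp_rw [hsing]
    have := LS.Ex_one p hsum n
    simpa [LS.Ex] using this
  have hRae : ∀ᵐ x ∂ν, x ∈ (R : Set (Fin n → ℝ)) := by
    have hR1 : ν (R : Set (Fin n → ℝ)) = 1 := by
      rw [measureReal_def, ENNReal.toReal_eq_one_iff] at hR
      exact hR
    exact (mem_ae_iff_prob_eq_one R.measurableSet).mpr hR1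
  have hrestr : ν.restrict (R : Set (Fin n → ℝ)) = ν := Measure.restrict_eq_self_of_ae_mem hRae
  have hExp : ∀ F : (Fin n → ℝ) → ℝ, ∫ y, F y ∂ν = LS.Ex p n (fun x => F (fun i => (x i : ℝ))) := by
    intro F
    rw [← hrestr, setIntegral_finset, Finset.sum_map]
    · simp_rw [hsing]
      rfl
    · exact IntegrableOn.finset
  have hprob : (ν {y | (∫ z, mlEval coeff z ∂ν) ≤ mlEval coeff y}).toReal =
      LS.Ex p n (fun x => if LS.Ex p n (fun x => mlEval coeff (fun i => (x i : ℝ))) ≤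
        mlEval coeff (fun i => (x i : ℝ)) then 1 else 0) := by
    have hm : Measurable (fun y : Fin n → ℝ => mlEval coeff y) := by
      unfold mlEval
      fun_prop
    have hA : MeasurableSet {y | (∫ z, mlEval coeff z ∂ν) ≤ mlEval coeff y} :=
      measurableSet_le measurable_const hm
    rw [← measureReal_def, ← integral_indicator_one hA, hExp]
    congr 1
    funext x
    rw [hExp]
    simp [Set.indicator_apply]
  have := LS.final p (fun a => (a : ℝ)) hlam hp hsum n d coeff hdeg
  exact this.trans (le_of_eq hprob.symm)
end

section
/- Let X be a finitely supported real random variable with E[X] = 0, Var[X] = 1, and minimum outcome probability λ. Let f be a multilinear polynomial of degree at most d with E[f(X^{⊗n})²] = 1. Then for all t ≥ (2e/λ)^{d/2}, E[f(X^{⊗n})²·1{|f(X^{⊗n})| > t}] ≤ t²·exp(−(λ d / (4e))·t^{2/d}). -/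
open MeasureTheory

lemma odd_bound (j m : ℕ) (hj : 1 ≤ j) (g w : ℝ) :
    ((2*(j+m+1)).choose (2*j+1) : ℝ) * g^(2*m+1) * w^(2*j+1) ≤
      1/3 * (((2*(j+m+1)).choose (2*j) : ℝ) * g^(2*m+2) * w^(2*j)) +
      (2*m+2)/(2*m+1) * (((2*(j+m+1)).choose (2*j+2) : ℝ) * g^(2*m) * w^(2*j+2)) := by
  set C0 : ℝ := ((2*(j+m+1)).choose (2*j) : ℝ)
  set C1 : ℝ := ((2*(j+m+1)).choose (2*j+1) : ℝ)
  set C2 : ℝ := ((2*(j+m+1)).choose (2*j+2) : ℝ)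
  have h1 : C1 * (2*j+1) = C0 * (2*m+2) := by
    have := Nat.choose_succ_right_eq (2*(j+m+1)) (2*j)
    rw [show 2*(j+m+1) - 2*j = 2*m+2 by omega] at this
    simp only [C0, C1]; exact_mod_cast this
  have h2 : C2 * (2*j+2) = C1 * (2*m+1) := by
    have := Nat.choose_succ_right_eq (2*(j+m+1)) (2*j+1)
    rw [show 2*(j+m+1) - (2*j+1) = 2*m+1 by omega] at this
    simp only [C2, C1]; exact_mod_cast this
  have hC1 : 0 ≤ C1 := Nat.cast_nonneg _
  have hj' : (1:ℝ) ≤ j := by exact_mod_cast hj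
  have hm : (0:ℝ) ≤ m := Nat.cast_nonneg _
  have e0 : C0 = C1 * ((2*j+1)/(2*m+2)) := by field_simp; linarith
  have e2 : C2 = C1 * ((2*m+1)/(2*j+2)) := by field_simp; linarith
  have key : g * w ≤ (2*j+1)/(2*m+2)/3 * g^2 + (2*m+2)/(2*j+2) * w^2 := by
    rw [div_div, div_mul_eq_mul_div, div_mul_eq_mul_div, div_add_div _ _ (by positivity) (by positivity),
      le_div_iff₀ (by positivity)]
    set P : ℝ := 2*j+1
    set Q : ℝ := 2*m+2
    have hP : 3 ≤ P := by simp only [P]; linarith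
    have hQ : 2 ≤ Q := by simp only [Q]; linarith
    have : (2*(j:ℝ)+2) = P + 1 := by simp only [P]; ring
    rw [this]
    have s1 : 0 ≤ ((P+1)/2*g - Q*w)^2 := sq_nonneg _
    nlinarith [mul_nonneg (mul_nonneg (by linarith : (0:ℝ) ≤ P+1) (by linarith : (0:ℝ) ≤ P-3)) (sq_nonneg g)]
  have hk : 0 ≤ C1 * (g^(2*m) * w^(2*j)) := by
    rw [pow_mul, pow_mul]; positivity
  have := mul_le_mul_of_nonneg_left key hk
  rw [e0, e2]
  have e3 : (2*(m:ℝ)+2)/(2*m+1) * (C1 * ((2*m+1)/(2*j+2)) * g^(2*m) * w^(2*j+2)) =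
    C1 * (g^(2*m) * w^(2*j)) * ((2*m+2)/(2*j+2) * w^2) := by
    field_simp
    ring
  rw [e3]
  calc _ = C1 * (g^(2*m) * w^(2*j)) * (g*w) := by ring
    _ ≤ _ := this
    _ = _ := by ring

lemma choose_bound (q j : ℕ) (hq : 2 ≤ q) (hj : 2 ≤ j) (hjq : j ≤ q) :
    3 * ((2*q).choose (2*j) : ℝ) ≤ (q.choose j : ℝ) * (2*q-1)^j := by
  have rel : ∀ i : ℕ, i < q → ((2*q).choose (2*(i+1)) : ℝ) * (2*i+1) * (q.choose i) = 
      ((2*q).choose (2*i)) * (2*q-2*i-1) * (q.choose (i+1)) := by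
    intro i hi
    have a1 := Nat.choose_succ_right_eq (2*q) (2*i)
    have a2 := Nat.choose_succ_right_eq (2*q) (2*i+1)
    have a3 := Nat.choose_succ_right_eq q i
    obtain ⟨k, rfl⟩ : ∃ k, q = i + k + 1 := ⟨q - i - 1, by omega⟩
    rw [show 2*(i+k+1) - 2*i = 2*k+2 by omega] at a1
    rw [show 2*(i+k+1) - (2*i+1) = 2*k+1 by omega] at a2
    rw [show (i+k+1) - i = k+1 by omega] at a3
    have b1 : (((2*(i+k+1)).choose (2*i+1) : ℕ):ℝ) * (2*i+1) = ((2*(i+k+1)).choose (2*i) : ℕ) * (2*k+2) := by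
      exact_mod_cast a1
    have b2 : (((2*(i+k+1)).choose (2*i+2) : ℕ):ℝ) * (2*i+2) = ((2*(i+k+1)).choose (2*i+1) : ℕ) * (2*k+1) := by
      exact_mod_cast a2
    have b3 : (((i+k+1).choose (i+1) : ℕ):ℝ) * (i+1) = ((i+k+1).choose i : ℕ) * (k+1) := by
      exact_mod_cast a3
    rw [show 2*(i+1) = 2*i+2 by ring]
    push_cast
    generalize (((2*(i+k+1)).choose (2*i+1) : ℕ):ℝ) = x1 at *
    generalize (((2*(i+k+1)).choose (2*i) : ℕ):ℝ) = x0 at *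
    generalize (((2*(i+k+1)).choose (2*i+2) : ℕ):ℝ) = x2 at *
    generalize (((i+k+1).choose (i+1) : ℕ):ℝ) = y1 at *
    generalize (((i+k+1).choose i : ℕ):ℝ) = y0 at *
    have hne : (2*(i:ℝ)+2)  ≠ 0 := by positivity
    apply mul_right_cancel₀ hne
    linear_combination (2*(i:ℝ)+1) * y0 * b2 + (2*k+1)*y0*b1 - 2*x0*(2*k+1) * b3
  have gen : ∀ i : ℕ, i < q → ∀ (K D : ℝ), 0 ≤ D → 0 ≤ K → D * (2*q-2*i-1) ≤ (2*q-1) * (2*i+1) →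
      K * ((2*q).choose (2*i) : ℝ) ≤ (q.choose i : ℝ) * (2*q-1)^i → 
      D * K * ((2*q).choose (2*(i+1)) : ℝ) ≤ (q.choose (i+1) : ℝ) * (2*q-1)^(i+1) := by
    intro i hi K D hD hK h1 h2
    have r := rel i hi
    have hpos : (0:ℝ) < (q.choose i) := by exact_mod_cast Nat.choose_pos hi.le
    have hiq : (i:ℝ)+1 ≤ q := by exact_mod_cast hi
    have hi0 : (0:ℝ) ≤ i := Nat.cast_nonneg _
    have hp2 : (0:ℝ) < (2*i+1) * (q.choose i) := by positivity
    rw [← mul_le_mul_iff_left₀ hp2]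
    have hy : (0:ℝ) ≤ q.choose (i+1) := Nat.cast_nonneg _
    calc D * K * ((2*q).choose (2*(i+1)) : ℝ) * ((2*i+1) * (q.choose i))
        = (D * (2*q-2*i-1)) * (K * ((2*q).choose (2*i))) * (q.choose (i+1)) := by
          linear_combination D * K * r
      _ ≤ ((2*q-1) * (2*i+1)) * ((q.choose i : ℝ) * (2*q-1)^i) * (q.choose (i+1)) := by
          gcongr
          nlinarith
      _ = _ := by ring
  have hq' : (2:ℝ) ≤ q := by exact_mod_cast hq
  induction j, hj using Nat.le_induction with
  | base =>
    have h1 := gen 0 (by omega) 1 1 (by norm_num) (by norm_num) (by push_cast; linarith) (by simp)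
    have h2 := gen 1 (by omega) 1 3 (by norm_num) (by norm_num) (by push_cast; linarith) (by simpa using h1)
    simpa using h2
  | succ j hj ih =>
    have := gen j (by omega) 3 1 (by norm_num) (by norm_num)
      (by have : (2:ℝ) ≤ j := by exact_mod_cast hj
          nlinarith) (ih (by omega))
    linarith

lemma sum_even_odd (F : ℕ → ℝ) (q : ℕ) :
    ∑ k ∈ Finset.range (2*q+1), F k = ∑ j ∈ Finset.range (q+1), F (2*j) + ∑ j ∈ Finset.range q, F (2*j+1) := by
  induction q with
  | zero => simp
  | succ q ih =>
    rw [show 2*(q+1)+1 = 2*q+1+1+1 by ring, Finset.sum_range_succ, Finset.sum_range_succ, ih,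
      Finset.sum_range_succ _ (q+1), Finset.sum_range_succ (fun j => F (2*j+1)) q]
    rw [show 2*(q+1) = 2*q+1+1 by ring]; ring

lemma pointwise (r : ℕ) (g w : ℝ) :
    (g+w)^(2*(r+2)) ≤ g^(2*(r+2)) + 2*(r+2) * g^(2*r+3) * w
      + 4/3 * ((r+2)*(2*r+3)) * g^(2*(r+1)) * w^2
      + ∑ i ∈ Finset.range (r+1), 3 * ((2*(r+2)).choose (2*(i+2)) : ℝ) * g^(2*(r-i)) * w^(2*(i+2)) := by
  let F : ℕ → ℝ := fun k => ((2*(r+2)).choose k : ℝ) * g^(2*(r+2)-k) * w^k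
  have e : (g+w)^(2*(r+2)) = ∑ k ∈ Finset.range (2*(r+2)+1), F k := by
    rw [add_comm, add_pow]
    apply Finset.sum_congr rfl; intro k _; simp only [F]; ring
  have hE : ∀ j, 0 ≤ F (2*j) := by
    intro j; simp only [F]
    rw [show 2*(r+2)-2*j = 2*(r+2-j) by omega, pow_mul, pow_mul]; positivity
  rw [e, sum_even_odd, Finset.sum_range_succ', Finset.sum_range_succ', Finset.sum_range_succ' (fun j => F (2*j+1))]
  have c2 : (((2*(r+2)).choose 2 : ℕ) : ℝ) = (r+2)*(2*r+3) := by
    rw [Nat.cast_choose_two]; push_cast; ring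
  have f0 : F (2*0) = g^(2*(r+2)) := by simp [F]
  have f1 : F (2*(0+1)) = (r+2)*(2*r+3) * g^(2*(r+1)) * w^2 := by
    simp only [F]; rw [show 2*(0+1) = 2 by rfl, c2, show 2*(r+2)-2 = 2*(r+1) by omega]
  have o0 : F (2*0+1) = 2*(r+2) * g^(2*r+3) * w := by
    simp only [F]; rw [show 2*(r+2)-(2*0+1) = 2*r+3 by omega]; simp
  have ob : ∀ i, i < r+1 → F (2*(i+1)+1) ≤ 1/3 * F (2*(i+1)) + 
      (2*((r-i:ℕ):ℝ)+2)/(2*((r-i:ℕ):ℝ)+1) * F (2*(i+2)) := by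
    intro i hi
    have := odd_bound (i+1) (r-i) (by omega) g w
    rw [show i+1+(r-i)+1 = r+2 by omega] at this
    simp only [F]
    rw [show 2*(r+2) - (2*(i+1)+1) = 2*(r-i)+1 by omega, show 2*(r+2) - (2*(i+1)) = 2*(r-i)+2 by omega,
      show 2*(r+2) - (2*(i+2)) = 2*(r-i) by omega]
    exact this
  have hsum : ∑ i ∈ Finset.range (r+1), F (2*(i+1)+1) ≤ 
     ∑ i ∈ Finset.range (r+1), (1/3 * F (2*(i+1)) + (2*((r-i:ℕ):ℝ)+2)/(2*((r-i:ℕ):ℝ)+1) * F (2*(i+2))) :=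
    Finset.sum_le_sum fun i hi => ob i (Finset.mem_range.1 hi)
  rw [Finset.sum_add_distrib, Finset.sum_range_succ' (fun i => 1/3 * F (2*(i+1))),
    Finset.sum_range_succ (fun i => (2*((r-i:ℕ):ℝ)+2)/(2*((r-i:ℕ):ℝ)+1) * F (2*(i+2)))] at hsum
  have hb : ∑ i ∈ Finset.range r, (2*((r-i:ℕ):ℝ)+2)/(2*((r-i:ℕ):ℝ)+1) * F (2*(i+2)) ≤
      ∑ i ∈ Finset.range r, 4/3 * F (2*(i+2)) := by
    apply Finset.sum_le_sum
    intro i hi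
    have : 1 ≤ r - i := by have := Finset.mem_range.1 hi; omega
    have h' : (1:ℝ) ≤ ((r-i:ℕ):ℝ) := by exact_mod_cast this
    apply mul_le_mul_of_nonneg_right _ (hE _)
    rw [div_le_div_iff₀ (by positivity) (by norm_num)]; linarith
  have hrr : (2*((r-r:ℕ):ℝ)+2)/(2*((r-r:ℕ):ℝ)+1) = 2 := by simp
  rw [hrr] at hsum
  have hfin : ∑ i ∈ Finset.range (r+1), 3 * ((2*(r+2)).choose (2*(i+2)) : ℝ) * g^(2*(r-i)) * w^(2*(i+2))
      = ∑ i ∈ Finset.range (r+1), 3 * F (2*(i+2)) := by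
    apply Finset.sum_congr rfl; intro i hi
    simp only [F]
    rw [show 2*(r+2) - (2*(i+2)) = 2*(r-i) by omega]; ring
  rw [hfin, f0, f1, o0]
  rw [f1] at hsum
  rw [← Finset.mul_sum] at hsum hb
  rw [← Finset.mul_sum, Finset.sum_range_succ (fun i => F (2*(i+2)))]
  simp only [show ∀ i, i+1+1 = i+2 from fun i => rfl] at *
  have hn : 0 ≤ ∑ i ∈ Finset.range r, F (2*(i+2)) := Finset.sum_nonneg fun i _ => hE _
  linarith

lemma one_var {Ω : Type*} [Fintype Ω] (p X : Ω → ℝ) (hp : ∀ a, 0 ≤ p a) (hp1 : ∑ a, p a = 1)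
    (hm : ∑ a, p a * X a = 0) (hv : ∑ a, p a * X a ^ 2 = 1) (lam kap : ℝ) (hlam : 0 < lam)
    (hl2 : lam ≤ 1/2) (hmin : ∀ a, p a ≠ 0 → lam ≤ p a) (q : ℕ) (hq : 1 ≤ q) (hk : 0 < kap)
    (hkq : kap ^ q = lam) (g h : ℝ) :
    ∑ a, p a * (g + X a * h)^(2*q) ≤ (g^2 + (2*q-1)*(kap/lam) * h^2)^q := by
  have hk1 : kap ≤ 1 := by
    by_contra hc
    have := one_lt_pow₀ (not_le.1 hc) (show q ≠ 0 by omega)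
    linarith
  have hX : ∀ a, p a ≠ 0 → lam * X a ^ 2 ≤ 1 := by
    intro a ha
    calc lam * X a ^ 2 ≤ p a * X a^2 := by gcongr; exact hmin a ha
      _ ≤ _ := by
        rw [← hv]
        exact Finset.single_le_sum (f := fun a => p a * X a^2) (fun b _ => mul_nonneg (hp b) (sq_nonneg _)) (Finset.mem_univ a)
  have hV : ∀ j : ℕ, ∑ a, p a * X a ^ (2*(j+1)) ≤ lam / lam^(j+1) := by
    intro j
    rw [le_div_iff₀ (by positivity), Finset.sum_mul]
    calc ∑ a, p a * X a ^ (2*(j+1)) * lam^(j+1) ≤ ∑ a, lam * (p a * X a ^2) := by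
          apply Finset.sum_le_sum
          intro a _
          by_cases ha : p a = 0
          · simp [ha]
          have h1 : (lam * X a ^2)^j ≤ 1 := pow_le_one₀ (by positivity) (hX a ha)
          calc _ = (lam * (p a * X a^2)) * (lam * X a^2)^j := by ring
            _ ≤ (lam * (p a * X a^2)) * 1 := by
              apply mul_le_mul_of_nonneg_left h1
              have := hp a; positivity
            _ = _ := by ring
      _ = lam := by rw [← Finset.mul_sum, hv, mul_one]
  rcases Nat.lt_or_ge q 2 with h2 | h2
  · have : q = 1 := by omega
    subst this
    have : kap = lam := by simpa using hkq
    subst this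
    rw [div_self hlam.ne']
    have : ∀ a, p a * (g + X a * h)^(2*1) = g^2 * p a + 2*g*h*(p a * X a) + h^2 * (p a * X a^2) := by intro a; ring
    simp only [this, Finset.sum_add_distrib, ← Finset.mul_sum, hp1, hm, hv]
    norm_num
  obtain ⟨r, rfl⟩ : ∃ r, q = r + 2 := ⟨q-2, by omega⟩
  have h43 : 4/3 * lam ≤ kap := by
    have e1 : (kap^(r+1))^2 ≤ 1/2 := by
      rw [← pow_mul]
      refine le_trans (pow_le_pow_of_le_one hk.le hk1 (show r+2 ≤ (r+1)*2 by omega)) (hkq ▸ hl2)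
    have e2 : kap^(r+1) ≤ 3/4 := by
      by_contra hc
      push Not at hc
      nlinarith
    calc 4/3 * lam = 4/3*kap^(r+1) * kap := by rw [← hkq]; ring
      _ ≤ 4/3*(3/4) * kap := by gcongr
      _ = kap := by ring
  have hlk : ∀ j, j ≤ r+2 → lam ≤ kap^j := by
    intro j hj; rw [← hkq]; exact pow_le_pow_of_le_one hk.le hk1 hj
  set M : ℝ := (2*((r+2:ℕ):ℝ)-1)*(kap/lam) with hM
  have hMM : M = (2*r+3)*(kap/lam) := by rw [hM]; push_cast; ring
  have rhs : (g^2 + M*h^2)^(r+2) = g^(2*(r+2)) + (r+2) * M * g^(2*(r+1)) * h^2 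
      + ∑ i ∈ Finset.range (r+1), ((r+2).choose (i+2) : ℝ) * M^(i+2) * g^(2*(r-i)) * h^(2*(i+2)) := by
    rw [add_comm, add_pow, Finset.sum_range_succ', Finset.sum_range_succ']
    rw [add_comm, add_comm (Finset.sum _ _), ← add_assoc]
    congr 1
    · congr 1
      · simp [← pow_mul]
      · simp [← pow_mul]; ring
    · apply Finset.sum_congr rfl
      intro i hi
      rw [show r+2-(i+1+1) = r-i by omega, ← pow_mul, mul_pow, ← pow_mul]; ring
  rw [rhs]
  have hg : ∀ m : ℕ, 0 ≤ g^(2*m) := fun m => by rw [pow_mul]; positivity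
  have hh : ∀ m : ℕ, 0 ≤ h^(2*m) := fun m => by rw [pow_mul]; positivity
  calc ∑ a, p a * (g + X a * h)^(2*(r+2)) ≤ ∑ a, p a * (g^(2*(r+2)) + 2*(r+2) * g^(2*r+3) * (X a * h)
      + 4/3 * ((r+2)*(2*r+3)) * g^(2*(r+1)) * (X a * h)^2
      + ∑ i ∈ Finset.range (r+1), 3 * ((2*(r+2)).choose (2*(i+2)) : ℝ) * g^(2*(r-i)) * (X a * h)^(2*(i+2))) := by
        apply Finset.sum_le_sum; intro a _
        exact mul_le_mul_of_nonneg_left (pointwise r g _) (hp a)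
    _ = g^(2*(r+2)) * (∑ a, p a) + 2*(r+2) * g^(2*r+3) * h * (∑ a, p a * X a) 
      + 4/3 * ((r+2)*(2*r+3)) * g^(2*(r+1)) * h^2 * (∑ a, p a * X a^2)
      + ∑ i ∈ Finset.range (r+1), 3 * ((2*(r+2)).choose (2*(i+2)) : ℝ) * g^(2*(r-i)) * h^(2*(i+2)) * (∑ a, p a * X a^(2*(i+2))) := by
        simp only [Finset.mul_sum]
        rw [Finset.sum_comm, ← Finset.sum_add_distrib, ← Finset.sum_add_distrib, ← Finset.sum_add_distrib]
        apply Finset.sum_congr rfl; intro a _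
        rw [mul_add, Finset.mul_sum]
        congr 1
        · ring
        · apply Finset.sum_congr rfl; intro i _
          rw [mul_pow]; ring
    _ ≤ _ := by
        rw [hp1, hm, hv]
        simp only [mul_one, mul_zero, add_zero]
        have t1 : 4/3 * (((r:ℝ)+2)*(2*r+3)) * g^(2*(r+1)) * h^2 ≤ (r+2) * M * g^(2*(r+1)) * h^2 := by
          apply mul_le_mul_of_nonneg_right _ (sq_nonneg h)
          apply mul_le_mul_of_nonneg_right _ (hg _)
          have : 4/3 ≤ kap/lam := by rw [le_div_iff₀ hlam]; exact h43
          rw [hMM]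
          calc _ = ((r:ℝ)+2)*((2*r+3)*(4/3)) := by ring
            _ ≤ _ := by gcongr
        have t2 : ∑ i ∈ Finset.range (r+1), 3 * ((2*(r+2)).choose (2*(i+2)) : ℝ) * g^(2*(r-i)) * h^(2*(i+2)) * (∑ a, p a * X a^(2*(i+2)))
           ≤ ∑ i ∈ Finset.range (r+1), ((r+2).choose (i+2) : ℝ) * M^(i+2) * g^(2*(r-i)) * h^(2*(i+2)) := by
          apply Finset.sum_le_sum
          intro i hi
          have hi' := Finset.mem_range.1 hi
          have cb := choose_bound (r+2) (i+2) (by omega) (by omega) (by omega)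
          have v := hV (i+1)
          have v2 : ∑ a, p a * X a^(2*(i+2)) ≤ (kap/lam)^(i+2) := by
            refine v.trans ?_
            rw [div_pow]
            exact div_le_div_of_nonneg_right (hlk _ (by omega)) (by positivity)
          have v0 : 0 ≤ ∑ a, p a * X a^(2*(i+2)) := Finset.sum_nonneg fun a _ => by
            rw [pow_mul]; have := hp a; positivity
          have c0 : (0:ℝ) ≤ 3 * ((2*(r+2)).choose (2*(i+2)) : ℝ) := by positivity
          have := mul_le_mul cb v2 v0 (c0.trans cb)
          have := mul_le_mul_of_nonneg_right this (mul_nonneg (hg (r-i)) (hh (i+2)))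
          rw [hM, mul_pow]
          linarith
        linarith

lemma minkowski {ι : Type*} [Fintype ι] (w G H : ι → ℝ) (hw : ∀ i, 0 ≤ w i) (hG : ∀ i, 0 ≤ G i)
    (hH : ∀ i, 0 ≤ H i) (q : ℕ) (A B : ℝ) (hA : 0 ≤ A) (hB : 0 ≤ B)
    (h1 : ∑ i, w i * G i ^ q ≤ A ^ q) (h2 : ∑ i, w i * H i ^ q ≤ B ^ q) :
    ∑ i, w i * (G i + H i)^q ≤ (A+B)^q := by
  have pos : ∀ A B : ℝ, 0 < A → 0 < B → ∑ i, w i * G i ^ q ≤ A ^ q → ∑ i, w i * H i ^ q ≤ B ^ q →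
    ∑ i, w i * (G i + H i)^q ≤ (A+B)^q := by
    intro A B hA hB h1 h2
    have key : ∀ i, (G i + H i)^q ≤ (A+B)^q * (A/(A+B) * (G i ^ q / A^q) + B/(A+B) * (H i ^q / B^q)) := by
      intro i
      have := (convexOn_pow q).2 (show G i / A ∈ Set.Ici (0:ℝ) from div_nonneg (hG i) hA.le)
        (show H i / B ∈ Set.Ici (0:ℝ) from div_nonneg (hH i) hB.le)
        (show 0 ≤ A/(A+B) by positivity) (show 0 ≤ B/(A+B) by positivity) (by field_simp)
      simp only [smul_eq_mul, div_pow] at this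
      refine le_trans (le_of_eq ?_) (mul_le_mul_of_nonneg_left this (by positivity))
      rw [← mul_pow]; congr 1; field_simp
    calc _ ≤ ∑ i, w i * ((A+B)^q * (A/(A+B) * (G i ^ q / A^q) + B/(A+B) * (H i ^q / B^q))) :=
          Finset.sum_le_sum fun i _ => mul_le_mul_of_nonneg_left (key i) (hw i)
      _ = (A+B)^q * (A/(A+B) * ((∑ i, w i * G i ^ q) / A^q) + B/(A+B) * ((∑ i, w i * H i ^ q) / B^q)) := by
          rw [Finset.sum_div, Finset.sum_div, Finset.mul_sum, Finset.mul_sum, ← Finset.sum_add_distrib, Finset.mul_sum]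
          apply Finset.sum_congr rfl; intro i _; ring
      _ ≤ (A+B)^q * (A/(A+B) * 1 + B/(A+B) * 1) := by
          gcongr
          · exact div_le_one_of_le₀ h1 (by positivity)
          · exact div_le_one_of_le₀ h2 (by positivity)
      _ = _ := by field_simp
  have lim : Filter.Tendsto (fun ε : ℝ => ((A+ε)+(B+ε))^q) (nhdsWithin 0 (Set.Ioi 0)) (nhds ((A+B)^q)) := by
    have : Continuous (fun ε : ℝ => ((A+ε)+(B+ε))^q) := by fun_prop
    have := this.tendsto 0
    simp only [add_zero] at this
    exact this.mono_left nhdsWithin_le_nhds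
  apply ge_of_tendsto lim
  filter_upwards [self_mem_nhdsWithin] with ε hε
  have hε : 0 < ε := hε
  exact pos _ _ (by positivity) (by positivity) (h1.trans (by gcongr; linarith)) (h2.trans (by gcongr; linarith))

lemma sum_finset_succ {n : ℕ} (φ : Finset (Fin (n+1)) → ℝ) :
    ∑ S, φ S = ∑ S : Finset (Fin n), φ (S.map (Fin.succEmb n)) +
      ∑ S : Finset (Fin n), φ (insert 0 (S.map (Fin.succEmb n))) := by
  have key : ∀ ψ : Finset (Fin (n+1)) → ℝ, ∑ S ∈ (Finset.univ.map (Fin.succEmb n)).powerset, ψ S =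
      ∑ S : Finset (Fin n), ψ (S.map (Fin.succEmb n)) := by
    intro ψ
    symm
    apply Finset.sum_bij (fun S _ => S.map (Fin.succEmb n))
    · intro S _
      rw [Finset.mem_powerset]
      exact Finset.map_subset_map.2 (Finset.subset_univ _)
    · intro S _ T _ h
      exact Finset.map_injective _ h
    · intro S hS
      obtain ⟨T, -, hT⟩ := Finset.subset_map_iff.1 (Finset.mem_powerset.1 hS)
      exact ⟨T, Finset.mem_univ _, hT.symm⟩
    · intros; rfl
  have h0 : (0 : Fin (n+1)) ∉ (Finset.univ.map (Fin.succEmb n)) := by simp [Fin.succ_ne_zero]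
  have hu : (Finset.univ : Finset (Finset (Fin (n+1)))) = (insert 0 (Finset.univ.map (Fin.succEmb n))).powerset := by
    rw [← Finset.powerset_univ]; congr 1
    ext i; simp
    rcases Fin.eq_zero_or_eq_succ i with h | ⟨j, rfl⟩ <;> simp [*]
  rw [hu, Finset.sum_powerset_insert h0, key, key]

lemma mlEval_cons {n : ℕ} (c : Finset (Fin (n+1)) → ℝ) (a : ℝ) (x : Fin n → ℝ) :
    mlEval c (Fin.cons a x) = mlEval (fun S => c (S.map (Fin.succEmb n))) x +
      a * mlEval (fun S => c (insert 0 (S.map (Fin.succEmb n)))) x := by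
  unfold mlEval
  rw [sum_finset_succ, Finset.mul_sum]
  congr 1
  · apply Finset.sum_congr rfl; intro S _; simp
  · apply Finset.sum_congr rfl; intro S _
    rw [Finset.prod_insert (by simp [Fin.succ_ne_zero])]
    simp; ring

lemma E_succ {Ω : Type*} [Fintype Ω] {n : ℕ} (p : Ω → ℝ) (F : (Fin (n+1) → Ω) → ℝ) :
    ∑ ω, (∏ i, p (ω i)) * F ω = ∑ ω : Fin n → Ω, (∏ i, p (ω i)) * ∑ a, p a * F (Fin.cons a ω) := by
  rw [← (Fin.consEquiv (fun _ : Fin (n+1) => Ω)).sum_comp, Fintype.sum_prod_type, Finset.sum_comm]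
  apply Finset.sum_congr rfl; intro ω _
  rw [Finset.mul_sum]
  apply Finset.sum_congr rfl; intro a _
  simp [Fin.consEquiv, Fin.prod_univ_succ]; ring

lemma ml_cons' {Ω : Type*} {n : ℕ} (c : Finset (Fin (n+1)) → ℝ) (X : Ω → ℝ) (a : Ω) (ω : Fin n → Ω) :
    mlEval c (fun i => X ((Fin.cons a ω : Fin (n+1) → Ω) i)) = mlEval (fun S => c (S.map (Fin.succEmb n))) (fun i => X (ω i)) +
      X a * mlEval (fun S => c (insert 0 (S.map (Fin.succEmb n)))) (fun i => X (ω i)) := by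
  rw [← mlEval_cons]
  congr 1
  ext i
  refine Fin.cases ?_ (fun j => ?_) i <;> simp

lemma orth {Ω : Type*} [Fintype Ω] (p X : Ω → ℝ) (hp1 : ∑ a, p a = 1)
    (hm : ∑ a, p a * X a = 0) (hv : ∑ a, p a * X a ^ 2 = 1) : ∀ (n : ℕ) (c : Finset (Fin n) → ℝ),
    ∑ ω : Fin n → Ω, (∏ i, p (ω i)) * (mlEval c (fun i => X (ω i)))^2 = ∑ S, c S ^ 2 := by
  intro n
  induction n with
  | zero =>
    intro c
    have hdef : (default : Finset (Fin 0)) = ∅ := Subsingleton.elim _ _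
    simp [mlEval, Finset.univ_unique, hdef]
  | succ n ih =>
    intro c
    rw [E_succ, sum_finset_succ, ← ih (fun S => c (S.map (Fin.succEmb n))), ← ih (fun S => c (insert 0 (S.map (Fin.succEmb n)))),
      ← Finset.sum_add_distrib]
    apply Finset.sum_congr rfl; intro ω _
    rw [← mul_add]; congr 1
    simp only [ml_cons']
    generalize mlEval _ _ = g
    generalize mlEval _ _ = h
    have : ∀ a, p a * (g + X a * h)^2 = g^2 * p a + 2*g*h*(p a * X a) + h^2 * (p a * X a^2) := by intro a; ring
    simp only [this, Finset.sum_add_distrib, ← Finset.mul_sum, hp1, hm, hv]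
    ring

lemma hyper {Ω : Type*} [Fintype Ω] (p X : Ω → ℝ) (hp : ∀ a, 0 ≤ p a) (M : ℝ) (hM : 0 ≤ M) (q : ℕ)
    (h1 : ∀ g h : ℝ, ∑ a, p a * (g + X a * h)^(2*q) ≤ (g^2 + M * h^2)^q) : ∀ (n : ℕ) (c : Finset (Fin n) → ℝ),
    ∑ ω : Fin n → Ω, (∏ i, p (ω i)) * (mlEval c (fun i => X (ω i)))^(2*q) ≤ (∑ S, M^S.card * c S ^ 2)^q := by
  intro n
  induction n with
  | zero =>
    intro c
    have hdef : (default : Finset (Fin 0)) = ∅ := Subsingleton.elim _ _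
    simp [mlEval, Finset.univ_unique, pow_mul, hdef]
  | succ n ih =>
    intro c
    rw [E_succ, sum_finset_succ]
    have hw : ∀ ω : Fin n → Ω, 0 ≤ ∏ i, p (ω i) := fun ω => Finset.prod_nonneg fun i _ => hp _
    have i0 := ih (fun S => c (S.map (Fin.succEmb n)))
    have i1 := ih (fun S => c (insert 0 (S.map (Fin.succEmb n))))
    have e1 : ∑ S : Finset (Fin n), M ^ (insert 0 (S.map (Fin.succEmb n))).card * c (insert 0 (S.map (Fin.succEmb n))) ^ 2
       = M * ∑ S : Finset (Fin n), M ^ S.card * c (insert 0 (S.map (Fin.succEmb n))) ^ 2 := by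
      rw [Finset.mul_sum]
      apply Finset.sum_congr rfl; intro S _
      rw [Finset.card_insert_of_notMem (by simp [Fin.succ_ne_zero]), Finset.card_map]; ring
    rw [e1]
    simp only [Finset.card_map]
    refine le_trans (Finset.sum_le_sum fun ω _ => mul_le_mul_of_nonneg_left (b := ∑ a, p a * _)
      (by simp only [ml_cons']; exact h1 _ _) (hw ω)) ?_
    apply minkowski _ _ _ hw (fun ω => sq_nonneg _) (fun ω => by positivity) q
    · exact Finset.sum_nonneg fun S _ => by positivity
    · exact mul_nonneg hM (Finset.sum_nonneg fun S _ => by positivity)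
    · simpa only [← pow_mul] using i0
    · rw [mul_pow]
      refine le_trans (le_of_eq ?_) (mul_le_mul_of_nonneg_left i1 (pow_nonneg hM q))
      rw [Finset.mul_sum]
      apply Finset.sum_congr rfl; intro ω _
      rw [mul_pow, ← pow_mul]; ring

lemma integral_fin {α : Type*} [MeasurableSpace α] [MeasurableSingletonClass α] (ν : Measure α) [IsProbabilityMeasure ν]
    (s : Finset α) (hs : ν ↑s = 1) (F : α → ℝ) : ∫ x, F x ∂ν = ∑ x ∈ s, ν.real {x} * F x := by
  have hae : ∀ᵐ x ∂ν, x ∈ (↑s : Set α) := by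
    rw [← prob_compl_eq_zero_iff s.measurableSet] at hs
    exact hs
  have : ν = ν.restrict ↑s := (Measure.restrict_eq_self_of_ae_mem hae).symm
  conv_lhs => rw [this]
  rw [setIntegral_finset _ IntegrableOn.finset]
  rfl

lemma integral_pi_fin {n : ℕ} (μ : Measure ℝ) [IsProbabilityMeasure μ]
    (s : Finset ℝ) (hs : μ ↑s = 1) (F : (Fin n → ℝ) → ℝ) :
    ∫ x, F x ∂(Measure.pi fun _ : Fin n => μ) = 
      ∑ ω : Fin n → s, (∏ i, μ.real {(ω i : ℝ)}) * F (fun i => ω i) := by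
  rw [integral_fin _ (Fintype.piFinset fun _ : Fin n => s) (by
    rw [Fintype.coe_piFinset, Measure.pi_pi]; simp [hs])]
  symm
  apply Finset.sum_bij (fun (ω : Fin n → s) _ => fun i => (ω i : ℝ))
  · intro ω _; simp
  · intro ω _ ω' _ h
    ext i; exact congrFun h i
  · intro x hx
    rw [Fintype.mem_piFinset] at hx
    exact ⟨fun i => ⟨x i, hx i⟩, Finset.mem_univ _, rfl⟩
  · intro ω _
    congr 1
    rw [measureReal_def, Measure.pi_singleton, ENNReal.toReal_prod]
    rfl

lemma lam_le_half {Ω : Type*} [Fintype Ω] (p X : Ω → ℝ) (hp : ∀ a, 0 ≤ p a) (hp1 : ∑ a, p a = 1)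
    (hm : ∑ a, p a * X a = 0) (hv : ∑ a, p a * X a ^ 2 = 1) (lam : ℝ)
    (hmin : ∀ a, p a ≠ 0 → lam ≤ p a) : lam ≤ 1/2 := by
  classical
  obtain ⟨a, -, ha⟩ : ∃ a ∈ Finset.univ, p a ≠ 0 := Finset.exists_ne_zero_of_sum_ne_zero (by rw [hp1]; norm_num)
  by_cases hb : ∃ b, b ≠ a ∧ p b ≠ 0
  · obtain ⟨b, hba, hb⟩ := hb
    have : ∑ x ∈ ({a, b} : Finset Ω), p x ≤ ∑ x, p x :=
      Finset.sum_le_sum_of_subset_of_nonneg (Finset.subset_univ _) fun i _ _ => hp i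
    rw [Finset.sum_pair hba.symm, hp1] at this
    linarith [hmin a ha, hmin b hb]
  · push Not at hb
    rw [Finset.sum_eq_single a (fun b _ h => by simp [hb b h]) (by simp)] at hp1 hm hv
    rw [hp1] at hm hv
    have : X a = 0 := by linarith
    rw [this] at hv; norm_num at hv

lemma final_num (lam u : ℝ) (hlam : 0 < lam) (hl : lam ≤ 1/2) (hu : 2 * Real.exp 1 ≤ u) :
    ∃ q : ℕ, 1 ≤ q ∧ lam * ((2*q-1)/u)^q ≤ Real.exp (-(u/(4*Real.exp 1))) := by
  have he := Real.exp_pos 1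
  have hu0 : 0 < u := by linarith
  set v := u / (2*Real.exp 1) with hv
  have hv1 : 1 ≤ v := by rw [hv, le_div_iff₀ (by positivity)]; linarith
  refine ⟨⌊v⌋₊, (Nat.one_le_floor_iff v).2 hv1, ?_⟩
  set q := ⌊v⌋₊
  have hq1 : 1 ≤ q := (Nat.one_le_floor_iff v).2 hv1
  have hq1' : (1:ℝ) ≤ q := by exact_mod_cast hq1
  have hqv : (q:ℝ) ≤ v := Nat.floor_le (by linarith)
  have hqv2 : v < q + 1 := Nat.lt_floor_add_one v
  have h1 : (2*(q:ℝ)-1)/u ≤ Real.exp (-1) := by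
    rw [div_le_iff₀ hu0, Real.exp_neg, inv_mul_eq_div, le_div_iff₀ he]
    rw [hv, le_div_iff₀ (by positivity)] at hqv
    nlinarith
  have h2 : ((2*(q:ℝ)-1)/u)^q ≤ Real.exp (-q) := by
    calc _ ≤ (Real.exp (-1))^q := pow_le_pow_left₀ (div_nonneg (by linarith) hu0.le) h1 q
      _ = _ := by rw [← Real.exp_nat_mul]; congr 1; ring
  have h3 : lam ≤ Real.exp (-(1/2)) := by
    linarith [Real.add_one_le_exp (-(1/2:ℝ))]
  have h4 : u/(4*Real.exp 1) = v/2 := by rw [hv]; field_simp; norm_num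
  calc _ ≤ Real.exp (-(1/2)) * Real.exp (-q) := mul_le_mul h3 h2 (pow_nonneg (div_nonneg (by linarith) hu0.le) _) (Real.exp_pos _).le
    _ ≤ _ := by
      rw [← Real.exp_add, Real.exp_le_exp, h4]; linarith

theorem stmt10 {n d : ℕ} (hd : 1 ≤ d) (μ : Measure ℝ) [IsProbabilityMeasure μ]
    (supp : Finset ℝ) (hsupp : μ ↑supp = 1)
    (hmean : ∫ x, x ∂μ = 0) (hvar : ∫ x, x ^ 2 ∂μ = 1)
    (lam : ℝ) (hlam : 0 < lam)
    (hmin : ∀ v ∈ supp, μ {v} ≠ 0 → lam ≤ (μ {v}).toReal)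
    (coeff : Finset (Fin n) → ℝ)
    (hdeg : ∀ S : Finset (Fin n), d < S.card → coeff S = 0)
    (hL2 : ∫ x, (mlEval coeff x) ^ 2 ∂(Measure.pi fun _ : Fin n => μ) = 1)
    (t : ℝ) (ht : (2 * Real.exp 1 / lam) ^ ((d : ℝ) / 2) ≤ t) :
    ∫ x, (if t < |mlEval coeff x| then (mlEval coeff x) ^ 2 else 0)
        ∂(Measure.pi fun _ : Fin n => μ) ≤
      t ^ 2 * Real.exp (-(lam * d / (4 * Real.exp 1)) * t ^ ((2 : ℝ) / d)) := by
  let p : supp → ℝ := fun a => μ.real {(a:ℝ)}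
  let X : supp → ℝ := fun a => a
  have hp : ∀ a, 0 ≤ p a := fun a => measureReal_nonneg
  have hfin : ∀ F : ℝ → ℝ, ∫ x, F x ∂μ = ∑ a : supp, p a * F (X a) := by
    intro F
    rw [integral_fin μ supp hsupp F, ← Finset.sum_coe_sort]
  have hp1 : ∑ a, p a = 1 := by
    have := hfin (fun _ => 1); simpa using this.symm
  have hm : ∑ a, p a * X a = 0 := by rw [← hmean]; exact (hfin (fun x => x)).symm
  have hv : ∑ a, p a * X a ^ 2 = 1 := by rw [← hvar]; exact (hfin (fun x => x^2)).symm
  have hmin' : ∀ a, p a ≠ 0 → lam ≤ p a := by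
    intro a ha
    exact hmin a a.2 (fun h0 => ha (by simp [p, measureReal_def, h0]))
  have hl2 := lam_le_half p X hp hp1 hm hv lam hmin'
  have hpi : ∀ F : (Fin n → ℝ) → ℝ, ∫ x, F x ∂(Measure.pi fun _ : Fin n => μ) = 
      ∑ ω : Fin n → supp, (∏ i, p (ω i)) * F (fun i => X (ω i)) := fun F => integral_pi_fin μ supp hsupp F
  rw [hpi, orth p X hp1 hm hv] at hL2
  rw [hpi]
  have he := Real.exp_pos 1
  have hb : 0 < 2 * Real.exp 1 / lam := by positivity
  have ht0 : 0 < t := lt_of_lt_of_le (Real.rpow_pos_of_pos hb _) ht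
  have hd0 : (0:ℝ) < d := by exact_mod_cast hd
  set τ := t ^ ((2:ℝ)/d) with hτ
  have hτ0 : 0 < τ := Real.rpow_pos_of_pos ht0 _
  have hτd : τ ^ d = t^2 := by
    rw [hτ, ← Real.rpow_natCast, ← Real.rpow_mul ht0.le, div_mul_cancel₀ _ hd0.ne']
    norm_num
  have hu : 2 * Real.exp 1 ≤ lam * τ := by
    have := Real.rpow_le_rpow (by positivity) ht (show 0 ≤ (2:ℝ)/d by positivity)
    rw [← Real.rpow_mul hb.le, show (d:ℝ)/2 * (2/d) = 1 by field_simp, Real.rpow_one, ← hτ, div_le_iff₀ hlam] at this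
    linarith
  obtain ⟨q, hq, hqb⟩ := final_num lam (lam*τ) hlam hl2 hu
  have hq1 : (1:ℝ) ≤ q := by exact_mod_cast hq
  set kap := lam ^ (1/(q:ℝ)) with hkap
  have hk0 : 0 < kap := Real.rpow_pos_of_pos hlam _
  have hkq : kap ^ q = lam := by
    rw [hkap, ← Real.rpow_natCast, ← Real.rpow_mul hlam.le, one_div_mul_cancel (by positivity), Real.rpow_one]
  have hkl : lam ≤ kap := by
    have : lam ^ (1:ℝ) ≤ lam ^ (1/(q:ℝ)) := Real.rpow_le_rpow_of_exponent_ge hlam (by linarith)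
      (by rw [div_le_one (by linarith)]; exact hq1)
    rwa [Real.rpow_one] at this
  set M : ℝ := (2*q-1)*(kap/lam) with hM
  have hkl1 : 1 ≤ kap/lam := by rw [le_div_iff₀ hlam]; linarith
  have hM1 : 1 ≤ M := by rw [hM]; nlinarith
  have hyp := hyper p X hp M (by linarith) q
    (one_var p X hp hp1 hm hv lam kap hlam hl2 hmin' q hq hk0 hkq) n coeff
  have hsum : ∑ S, M^S.card * coeff S ^ 2 ≤ M^d := by
    calc _ ≤ ∑ S, M^d * coeff S^2 := by
          apply Finset.sum_le_sum; intro S _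
          by_cases hS : d < S.card
          · simp [hdeg S hS]
          · apply mul_le_mul_of_nonneg_right _ (sq_nonneg _)
            exact pow_le_pow_right₀ hM1 (not_lt.1 hS)
      _ = _ := by rw [← Finset.mul_sum, hL2, mul_one]
  have hyp2 := hyp.trans (pow_le_pow_left₀ (Finset.sum_nonneg fun S _ => by positivity) hsum q)
  obtain ⟨r, rfl⟩ : ∃ r, q = r + 1 := ⟨q-1, by omega⟩
  have hw : ∀ ω : Fin n → supp, 0 ≤ ∏ i, p (ω i) := fun ω => Finset.prod_nonneg fun i _ => hp _
  calc _ ≤ ∑ ω : Fin n → supp, (∏ i, p (ω i)) * ((mlEval coeff fun i => X (ω i))^(2*(r+1)) / t^(2*r)) := by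
        apply Finset.sum_le_sum; intro ω _
        apply mul_le_mul_of_nonneg_left _ (hw ω)
        generalize (mlEval coeff fun i => X (ω i)) = y
        have hy : y^(2*(r+1)) = y^2 * |y|^(2*r) := by
          rw [pow_mul |y|, sq_abs, ← pow_mul]; ring
        split_ifs with hty
        · rw [le_div_iff₀ (by positivity), hy]
          gcongr
        · rw [hy]; positivity
    _ = (∑ ω : Fin n → supp, (∏ i, p (ω i)) * (mlEval coeff fun i => X (ω i))^(2*(r+1))) / t^(2*r) := by
        rw [Finset.sum_div]; apply Finset.sum_congr rfl; intro ω _; ring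
    _ ≤ (M^d)^(r+1) / t^(2*r) := by gcongr
    _ = t^2 * (lam * ((2*(r+1:ℕ)-1)/(lam*τ))^(r+1))^d := by
        have : lam * ((2*(r+1:ℕ)-1)/(lam*τ))^(r+1) = (M/τ)^(r+1) := by
          rw [hM, ← hkq]
          simp only [div_pow, mul_pow]
          rw [hkq]
          field_simp
        rw [this, ← pow_mul (M/τ), mul_comm (r+1) d, pow_mul (M/τ), div_pow, div_pow, hτd, ← pow_mul t]
        field_simp
        ring
    _ ≤ t^2 * (Real.exp (-(lam*τ/(4*Real.exp 1))))^d := by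
        gcongr
        apply mul_nonneg hlam.le
        apply pow_nonneg
        apply div_nonneg <;> first | positivity | linarith
    _ = _ := by
        rw [← Real.exp_nat_mul]; congr 2; ring
end

section
/- Let q₁ be a degree-d multilinear polynomial in ds variables with ‖q₁‖_coeff = 1, and q₂ a degree-d multilinear polynomial in N ≥ ds variables with ‖q₁ − q₂‖_coeff ≤ η ≤ 1. Let X be a finitely supported random variable with mean 0 and variance 1. Then for each positive integer k there is a constant ξ (depending only on k, d, and X) such that Mom_k(q₁(X^{⊗ds}), q₂(X^{⊗N})) ≤ ξ·η. -/
open MeasureTheory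

lemma aux_taylor (n : ℕ) : ∃ C : ℝ, 0 < C ∧ ∀ a t s : ℝ, |a| ≤ s → |t| ≤ s →
    ∃ R : ℝ, |R| ≤ C * s ^ n ∧
      (a + t) ^ (n + 2) = a ^ (n + 2) + (n + 2) * a ^ (n + 1) * t + t ^ 2 * R := by
  induction n with
  | zero =>
    refine ⟨1, one_pos, fun a t s _ _ => ⟨1, by simp, ?_⟩⟩
    push_cast; ring
  | succ n ih =>
    obtain ⟨C, hC, h⟩ := ih
    refine ⟨(n + 2) + 2 * C, by positivity, fun a t s ha ht => ?_⟩
    obtain ⟨R, hR, hE⟩ := h a t s ha ht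
    have hs : 0 ≤ s := (abs_nonneg a).trans ha
    refine ⟨(n + 2) * a ^ (n + 1) + (a + t) * R, ?_, ?_⟩
    · have h1 : |((n : ℝ) + 2) * a ^ (n + 1)| ≤ (n + 2) * s ^ (n + 1) := by
        rw [abs_mul, abs_pow, abs_of_nonneg (by positivity : (0 : ℝ) ≤ (n : ℝ) + 2)]
        gcongr
      have h2 : |(a + t) * R| ≤ (2 * s) * (C * s ^ n) := by
        rw [abs_mul]
        have : |a + t| ≤ 2 * s := (abs_add_le a t).trans (by linarith)
        gcongr
      calc _ ≤ _ := abs_add_le _ _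
        _ ≤ (n + 2) * s ^ (n + 1) + (2 * s) * (C * s ^ n) := add_le_add h1 h2
        _ = _ := by ring
    · rw [show n + 1 + 2 = (n + 2) + 1 by ring, pow_succ (a + t), hE]
      push_cast; ring

lemma aux_bdd (μ : Measure ℝ) [IsProbabilityMeasure μ]
    (supp : Finset ℝ) (hsupp : μ ↑supp = 1) :
    ∃ B : ℝ, 0 < B ∧ ∀ᵐ x ∂μ, |x| ≤ B := by
  refine ⟨1 + ∑ y ∈ supp, |y|, by positivity, ?_⟩
  have h : ∀ᵐ x ∂μ, x ∈ (supp : Set ℝ) :=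
    (prob_compl_eq_zero_iff supp.measurableSet).2 hsupp
  filter_upwards [h] with x hx
  have := Finset.single_le_sum (f := fun y : ℝ => |y|) (fun i _ => abs_nonneg i)
    (Finset.mem_coe.1 hx)
  linarith

lemma aux_int1 (μ : Measure ℝ) [IsProbabilityMeasure μ] (B : ℝ) (hB : ∀ᵐ x ∂μ, |x| ≤ B)
    (f : ℝ → ℝ) (hf : Continuous f) : Integrable f μ := by
  have h : μ.restrict (Set.Icc (-B) B) = μ :=
    Measure.restrict_eq_self_of_ae_mem (by filter_upwards [hB] with x hx using abs_le.1 hx)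
  rw [← h]
  exact hf.continuousOn.integrableOn_compact isCompact_Icc

lemma aux_int (μ : Measure ℝ) [IsProbabilityMeasure μ] (B : ℝ) (hB : ∀ᵐ x ∂μ, |x| ≤ B)
    {n : ℕ} (f : (Fin n → ℝ) → ℝ) (hf : Continuous f) :
    Integrable f (Measure.pi fun _ : Fin n => μ) := by
  have h : (Measure.pi fun _ : Fin n => μ).restrict
      (Set.Icc (fun _ => -B) (fun _ => B)) = Measure.pi fun _ : Fin n => μ := by
    apply Measure.restrict_eq_self_of_ae_mem
    have : ∀ i : Fin n, ∀ᵐ x ∂(Measure.pi fun _ : Fin n => μ), |x i| ≤ B := fun i =>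
      (Measure.quasiMeasurePreserving_eval (fun _ : Fin n => μ) i).ae hB
    filter_upwards [ae_all_iff.2 this] with x hx
    exact ⟨fun i => (abs_le.1 (hx i)).1, fun i => (abs_le.1 (hx i)).2⟩
  rw [← h]
  exact hf.continuousOn.integrableOn_compact isCompact_Icc

lemma mlEval_cont {n : ℕ} (c : Finset (Fin n) → ℝ) : Continuous (mlEval c) := by
  unfold mlEval; fun_prop

lemma aux_fubini (μ : Measure ℝ) [IsProbabilityMeasure μ] (B : ℝ) (hB : ∀ᵐ x ∂μ, |x| ≤ B)
    {n : ℕ} (f : (Fin (n + 1) → ℝ) → ℝ) (hf : Continuous f) :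
    ∫ x, f x ∂(Measure.pi fun _ : Fin (n + 1) => μ) =
      ∫ y, ∫ x, f (Fin.cons x y) ∂μ ∂(Measure.pi fun _ : Fin n => μ) := by
  have hp := (measurePreserving_piFinSuccAbove (fun _ : Fin (n + 1) => μ) 0).symm
  have hi := aux_int μ B hB f hf
  rw [← hp.integral_comp']
  have hi2 := (hp.integrable_comp_emb (MeasurableEquiv.measurableEmbedding _)).2 hi
  refine (integral_prod_symm _ hi2).trans ?_
  simp [MeasurableEquiv.piFinSuccAbove, Fin.insertNthEquiv]

lemma aux_sum {n : ℕ} (f : Finset (Fin (n + 1)) → ℝ) :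
    ∑ S, f S = ∑ S : Finset (Fin n), f (S.map (Fin.succEmb n)) +
      ∑ S : Finset (Fin n), f (insert 0 (S.map (Fin.succEmb n))) := by
  have key : ∀ g : Finset (Fin (n + 1)) → ℝ,
      ∑ S ∈ (Finset.univ.map (Fin.succEmb n)).powerset, g S =
        ∑ S : Finset (Fin n), g (S.map (Fin.succEmb n)) := by
    intro g
    symm
    refine Finset.sum_bij (fun S _ => S.map (Fin.succEmb n)) ?_ ?_ ?_ ?_
    · intro S _
      simp only [Finset.mem_powerset]
      exact Finset.map_subset_map.2 (Finset.subset_univ _)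
    · intro S _ T _ h
      exact Finset.map_injective _ h
    · intro T hT
      obtain ⟨u, _, hu⟩ := Finset.subset_map_iff.1 (Finset.mem_powerset.1 hT)
      exact ⟨u, Finset.mem_univ _, hu.symm⟩
    · intros; rfl
  have h0 : (0 : Fin (n + 1)) ∉ Finset.univ.map (Fin.succEmb n) := by
    simp
  have hu : (Finset.univ : Finset (Fin (n + 1))) =
      insert 0 (Finset.univ.map (Fin.succEmb n)) := by
    ext i
    refine Fin.cases ?_ (fun j => ?_) i <;> simp
  rw [← Finset.powerset_univ, hu, Finset.sum_powerset_insert h0, key, key]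

lemma aux_eval {n : ℕ} (ρ : ℝ) (c : Finset (Fin (n + 1)) → ℝ) (x : ℝ) (y : Fin n → ℝ) :
    mlEval (fun S => c S * ρ ^ S.card) (Fin.cons x y) =
      mlEval (fun S : Finset (Fin n) => c (S.map (Fin.succEmb n)) * ρ ^ S.card) y +
      (ρ * mlEval (fun S : Finset (Fin n) =>
        c (insert 0 (S.map (Fin.succEmb n))) * ρ ^ S.card) y) * x := by
  have h0 : ∀ S : Finset (Fin n), (0 : Fin (n + 1)) ∉ S.map (Fin.succEmb n) := by
    intro S; simp
  unfold mlEval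
  rw [aux_sum]
  congr 1
  · simp
  · rw [Finset.mul_sum, Finset.sum_mul]
    refine Finset.sum_congr rfl fun S _ => ?_
    beta_reduce
    rw [Finset.prod_insert (h0 S), Finset.card_insert_of_notMem (h0 S)]
    simp
    ring

lemma aux_one (μ : Measure ℝ) [IsProbabilityMeasure μ] (B : ℝ) (hB0 : 0 < B)
    (hB : ∀ᵐ x ∂μ, |x| ≤ B) (hmean : ∫ x, x ∂μ = 0) (hvar : ∫ x, x ^ 2 ∂μ = 1) (m : ℕ) :
    ∃ ρ : ℝ, 0 < ρ ∧ ρ ≤ 1 ∧ ∀ a b : ℝ,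
      ∫ x, (a + (ρ * b) * x) ^ (2 * (m + 1)) ∂μ ≤ (a ^ 2 + b ^ 2) ^ (m + 1) := by
  obtain ⟨C, hC, hT⟩ := aux_taylor (2 * m)
  refine ⟨1 / (1 + B + C), by positivity, ?_, fun a b => ?_⟩
  · rw [div_le_one (by positivity)]; linarith
  set ρ := 1 / (1 + B + C) with hρ
  have hρ0 : 0 < ρ := by positivity
  have hρ1 : ρ * (1 + B + C) = 1 := by rw [hρ]; field_simp
  have hρB : ρ * B ≤ 1 := by nlinarith
  have hρC : C * ρ ^ 2 ≤ 1 := by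
    have h1 : ρ * C ≤ 1 := by nlinarith
    have h2 : ρ ≤ 1 := by nlinarith
    nlinarith
  set s := Real.sqrt (a ^ 2 + b ^ 2) with hs
  have hs2 : s ^ 2 = a ^ 2 + b ^ 2 := Real.sq_sqrt (by positivity)
  have has : |a| ≤ s := Real.abs_le_sqrt (by nlinarith [sq_nonneg b])
  have hbs : |b| ≤ s := Real.abs_le_sqrt (by nlinarith [sq_nonneg a])
  have hpt : ∀ᵐ x ∂μ, (a + (ρ * b) * x) ^ (2 * (m + 1)) ≤
      a ^ (2 * m + 2) + ((2 * m + 2) * a ^ (2 * m + 1) * (ρ * b)) * x +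
        (ρ ^ 2 * b ^ 2 * (C * s ^ (2 * m))) * x ^ 2 := by
    filter_upwards [hB] with x hx
    have ht : |ρ * b * x| ≤ s := by
      rw [abs_mul, abs_mul, abs_of_pos hρ0]
      calc ρ * |b| * |x| ≤ ρ * |b| * B := by gcongr
        _ = |b| * (ρ * B) := by ring
        _ ≤ |b| * 1 := by gcongr
        _ ≤ s := by linarith
    obtain ⟨R, hR, hE⟩ := hT a (ρ * b * x) s has ht
    rw [show 2 * (m + 1) = 2 * m + 2 by ring, hE]
    have := mul_le_mul_of_nonneg_left ((le_abs_self R).trans hR) (sq_nonneg (ρ * b * x))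
    push_cast
    nlinarith
  have hI : ∀ f : ℝ → ℝ, Continuous f → Integrable f μ := aux_int1 μ B hB
  calc ∫ x, (a + (ρ * b) * x) ^ (2 * (m + 1)) ∂μ
      ≤ ∫ x, (a ^ (2 * m + 2) + ((2 * m + 2) * a ^ (2 * m + 1) * (ρ * b)) * x +
        (ρ ^ 2 * b ^ 2 * (C * s ^ (2 * m))) * x ^ 2) ∂μ :=
        integral_mono_ae (hI _ (by fun_prop)) (hI _ (by fun_prop)) hpt
    _ = a ^ (2 * m + 2) + ρ ^ 2 * b ^ 2 * (C * s ^ (2 * m)) := by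
        rw [integral_add (hI _ (by fun_prop)) (hI _ (by fun_prop)),
          integral_add (hI _ (by fun_prop)) (hI _ (by fun_prop)),
          integral_const_mul, integral_const_mul, hmean, hvar]
        simp
    _ ≤ a ^ 2 * s ^ (2 * m) + b ^ 2 * s ^ (2 * m) := by
        have h1 : a ^ (2 * m + 2) ≤ a ^ 2 * s ^ (2 * m) := by
          rw [pow_add, mul_comm, pow_mul, pow_mul, hs2]
          gcongr
          nlinarith [sq_nonneg b]
        have h2 : ρ ^ 2 * b ^ 2 * (C * s ^ (2 * m)) ≤ b ^ 2 * s ^ (2 * m) := by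
          have h3 : 0 ≤ b ^ 2 * s ^ (2 * m) := by positivity
          nlinarith
        linarith
    _ = (a ^ 2 + b ^ 2) ^ (m + 1) := by
        rw [pow_mul, hs2]; ring

lemma aux_convex (u v Q R : ℝ) (hu : 0 ≤ u) (hv : 0 ≤ v) (hQ : 0 < Q) (hR : 0 < R) (m : ℕ) :
    (u + v) ^ m ≤ (Q + R) ^ m * (Q / (Q + R)) / Q ^ m * u ^ m +
      (Q + R) ^ m * (R / (Q + R)) / R ^ m * v ^ m := by
  have h := (convexOn_pow (𝕜 := ℝ) m).2
    (show u / Q ∈ Set.Ici (0 : ℝ) from div_nonneg hu hQ.le)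
    (show v / R ∈ Set.Ici (0 : ℝ) from div_nonneg hv hR.le)
    (show 0 ≤ Q / (Q + R) by positivity) (show 0 ≤ R / (Q + R) by positivity)
    (by field_simp)
  simp only [smul_eq_mul] at h
  have e : Q / (Q + R) * (u / Q) + R / (Q + R) * (v / R) = (u + v) / (Q + R) := by
    field_simp
  rw [e, div_pow, div_le_iff₀ (by positivity)] at h
  refine h.trans (le_of_eq ?_)
  rw [div_pow, div_pow]
  ring

lemma aux_hyper (μ : Measure ℝ) [IsProbabilityMeasure μ] (B : ℝ)
    (hB : ∀ᵐ x ∂μ, |x| ≤ B) (m : ℕ) (ρ : ℝ)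
    (h1 : ∀ a b : ℝ,
      ∫ x, (a + (ρ * b) * x) ^ (2 * (m + 1)) ∂μ ≤ (a ^ 2 + b ^ 2) ^ (m + 1)) (n : ℕ) :
    ∀ (c : Finset (Fin n) → ℝ) (Q : ℝ), ∑ S, c S ^ 2 < Q →
      ∫ x, (mlEval (fun S => c S * ρ ^ S.card) x) ^ (2 * (m + 1))
        ∂(Measure.pi fun _ : Fin n => μ) ≤ Q ^ (m + 1) := by
  induction n with
  | zero =>
    intro c Q hQ
    have hd : (default : Finset (Fin 0)) = ∅ := Subsingleton.elim _ _
    have hQ' : c ∅ ^ 2 < Q := by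
      simpa [Finset.univ_unique, hd] using hQ
    have : ∀ x, mlEval (fun S => c S * ρ ^ S.card) x = c ∅ := by
      intro x; simp [mlEval, Finset.univ_unique, hd]
    simp only [this]
    simp only [integral_const, probReal_univ, one_smul]
    rw [pow_mul]
    exact pow_le_pow_left₀ (sq_nonneg _) hQ'.le _
  | succ n ih =>
    intro c Q hQ
    rw [aux_sum] at hQ
    set c₀ : Finset (Fin n) → ℝ := fun S => c (S.map (Fin.succEmb n)) with hc₀
    set c₁ : Finset (Fin n) → ℝ := fun S => c (insert 0 (S.map (Fin.succEmb n))) with hc₁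
    set A := ∑ S, c₀ S ^ 2 with hA
    set D := ∑ S, c₁ S ^ 2 with hD
    have hA0 : 0 ≤ A := Finset.sum_nonneg fun _ _ => sq_nonneg _
    have hD0 : 0 ≤ D := Finset.sum_nonneg fun _ _ => sq_nonneg _
    have hQ2 : A + D < Q := hQ
    set δ := (Q - A - D) / 2 with hδ
    have hδ0 : 0 < δ := by rw [hδ]; linarith
    have i0 := ih c₀ (A + δ) (by linarith)
    have i1 := ih c₁ (D + δ) (by linarith)
    set P₀ := mlEval (fun S => c₀ S * ρ ^ S.card) with hP₀
    set P₁ := mlEval (fun S => c₁ S * ρ ^ S.card) with hP₁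
    have cP₀ : Continuous P₀ := mlEval_cont _
    have cP₁ : Continuous P₁ := mlEval_cont _
    have cP : Continuous (mlEval (fun S => c S * ρ ^ S.card)) := mlEval_cont _
    have hI : ∀ f : (Fin n → ℝ) → ℝ, Continuous f →
      Integrable f (Measure.pi fun _ : Fin n => μ) := aux_int μ B hB
    have hQ1 : 0 < A + δ := by linarith
    have hR1 : 0 < D + δ := by linarith
    have hsum : A + δ + (D + δ) = Q := by rw [hδ]; ring
    have hQ0 : 0 < Q := by linarith
    rw [aux_fubini μ B hB _ (by fun_prop)]
    set α := Q ^ (m + 1) * ((A + δ) / Q) / (A + δ) ^ (m + 1) with hα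
    set β := Q ^ (m + 1) * ((D + δ) / Q) / (D + δ) ^ (m + 1) with hβ
    calc _ ≤ ∫ y, (α * P₀ y ^ (2 * (m + 1)) + β * P₁ y ^ (2 * (m + 1)))
          ∂(Measure.pi fun _ : Fin n => μ) := by
          refine integral_mono_of_nonneg (Filter.Eventually.of_forall fun y =>
            integral_nonneg fun x => ?_) (hI _ (by fun_prop))
            (Filter.Eventually.of_forall fun y => ?_)
          · exact (even_two_mul _).pow_nonneg _
          · simp only [aux_eval]
            refine (h1 (P₀ y) (P₁ y)).trans ?_
            have := aux_convex (P₀ y ^ 2) (P₁ y ^ 2) (A + δ) (D + δ) (sq_nonneg _)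
              (sq_nonneg _) hQ1 hR1 (m + 1)
            rw [hsum] at this
            rw [pow_mul, pow_mul]
            exact this
      _ = α * ∫ y, P₀ y ^ (2 * (m + 1)) ∂(Measure.pi fun _ : Fin n => μ) +
          β * ∫ y, P₁ y ^ (2 * (m + 1)) ∂(Measure.pi fun _ : Fin n => μ) := by
          rw [integral_add (hI _ (by fun_prop)) (hI _ (by fun_prop)),
            integral_const_mul, integral_const_mul]
      _ ≤ α * (A + δ) ^ (m + 1) + β * (D + δ) ^ (m + 1) := by
          gcongr
      _ = Q ^ (m + 1) * ((A + δ + (D + δ)) / Q) := by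
          rw [hα, hβ, div_mul_cancel₀ _ (by positivity), div_mul_cancel₀ _ (by positivity)]
          ring
      _ = Q ^ (m + 1) := by
          rw [hsum, div_self hQ0.ne', mul_one]

lemma aux_moment (μ : Measure ℝ) [IsProbabilityMeasure μ] (B : ℝ) (hB0 : 0 < B)
    (hB : ∀ᵐ x ∂μ, |x| ≤ B) (hmean : ∫ x, x ∂μ = 0) (hvar : ∫ x, x ^ 2 ∂μ = 1)
    (d m : ℕ) :
    ∃ K : ℝ, 0 < K ∧ ∀ (n : ℕ) (c : Finset (Fin n) → ℝ) (Q : ℝ),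
      (∀ S, d < S.card → c S = 0) → ∑ S, c S ^ 2 < Q →
      ∫ x, (mlEval c x) ^ (2 * m) ∂(Measure.pi fun _ : Fin n => μ) ≤ K * Q ^ m := by
  cases m with
  | zero => exact ⟨1, one_pos, fun n c Q _ _ => by simp⟩
  | succ m =>
    obtain ⟨ρ, hρ0, hρ1, h1⟩ := aux_one μ B hB0 hB hmean hvar m
    refine ⟨((ρ ^ d)⁻¹ ^ 2) ^ (m + 1), by positivity, fun n c Q hc hQ => ?_⟩
    have h := aux_hyper μ B hB m ρ h1 n (fun S => c S * (ρ ^ S.card)⁻¹)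
      ((ρ ^ d)⁻¹ ^ 2 * Q) ?_
    · have e : (fun S : Finset (Fin n) => c S * (ρ ^ S.card)⁻¹ * ρ ^ S.card) = c := by
        funext S
        field_simp
      simp only [e] at h
      rwa [mul_pow] at h
    · calc ∑ S : Finset (Fin n), (c S * (ρ ^ S.card)⁻¹) ^ 2
          ≤ ∑ S : Finset (Fin n), (ρ ^ d)⁻¹ ^ 2 * c S ^ 2 := by
            refine Finset.sum_le_sum fun S _ => ?_
            by_cases hS : d < S.card
            · simp [hc S hS]
            · rw [mul_pow, mul_comm]
              have : ρ ^ d ≤ ρ ^ S.card :=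
                pow_le_pow_of_le_one hρ0.le hρ1 (not_lt.1 hS)
              gcongr
        _ = (ρ ^ d)⁻¹ ^ 2 * ∑ S, c S ^ 2 := by rw [Finset.mul_sum]
        _ < _ := by gcongr

lemma aux_pt (a b η : ℝ) (hη : 0 < η) (n : ℕ) :
    |a ^ (n + 1) - b ^ (n + 1)| ≤ η⁻¹ * (a - b) ^ (2 * 1) +
      η * (n + 1) ^ 2 * (a ^ (2 * n) + b ^ (2 * n)) := by
  have h := abs_pow_sub_pow_le a b (n + 1)
  simp only [Nat.add_sub_cancel] at h
  set M := max |a| |b| ^ n with hM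
  have hM0 : 0 ≤ M := by positivity
  have hM2 : M ^ 2 ≤ a ^ (2 * n) + b ^ (2 * n) := by
    have e : ∀ z : ℝ, z ^ (2 * n) = (|z| ^ n) ^ 2 := by
      intro z; rw [← pow_mul, mul_comm n 2, pow_mul, pow_mul, sq_abs]
    rw [e a, e b, hM]
    rcases max_choice |a| |b| with h | h <;> rw [h]
    · nlinarith [sq_nonneg (|b| ^ n)]
    · nlinarith [sq_nonneg (|a| ^ n)]
  have h2 : |a - b| * ((n : ℝ) + 1) * M ≤ η⁻¹ * (a - b) ^ 2 + η * (n + 1) ^ 2 * M ^ 2 := by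
    set w := ((n : ℝ) + 1) * M with hw
    have hw0 : 0 ≤ w := by positivity
    have key : 0 ≤ η⁻¹ * (|a - b| - η * w) ^ 2 := by positivity
    have e1 : η⁻¹ * (|a - b| - η * w) ^ 2 =
        η⁻¹ * (a - b) ^ 2 - 2 * (|a - b| * w) + η * w ^ 2 := by
      rw [← sq_abs (a - b)]; field_simp
      ring
    have e2 : 0 ≤ |a - b| * w := by positivity
    have e3 : η * w ^ 2 = η * (n + 1) ^ 2 * M ^ 2 := by rw [hw]; ring
    have e4 : |a - b| * ((n : ℝ) + 1) * M = |a - b| * w := by rw [hw]; ring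
    linarith
  have h3 : η * (n + 1) ^ 2 * M ^ 2 ≤ η * (n + 1) ^ 2 * (a ^ (2 * n) + b ^ (2 * n)) := by
    gcongr
  push_cast at h
  rw [mul_one]
  linarith

lemma mlEval_sub {n : ℕ} (p q : Finset (Fin n) → ℝ) (x : Fin n → ℝ) :
    mlEval (fun S => p S - q S) x = mlEval p x - mlEval q x := by
  simp [mlEval, sub_mul]

lemma aux_diff (μ : Measure ℝ) [IsProbabilityMeasure μ] (B : ℝ) (hB0 : 0 < B)
    (hB : ∀ᵐ x ∂μ, |x| ≤ B) (hmean : ∫ x, x ∂μ = 0) (hvar : ∫ x, x ^ 2 ∂μ = 1)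
    (d i : ℕ) :
    ∃ K : ℝ, 0 < K ∧ ∀ (N : ℕ) (p q : Finset (Fin N) → ℝ) (η : ℝ),
      (∀ S, d < S.card → p S = 0) → (∀ S, d < S.card → q S = 0) →
      ∑ S, p S ^ 2 = 1 → 0 < η → η ≤ 1 → ∑ S, (p S - q S) ^ 2 ≤ η ^ 2 →
      |(∫ x, (mlEval p x) ^ (i + 1) ∂(Measure.pi fun _ : Fin N => μ)) -
        ∫ x, (mlEval q x) ^ (i + 1) ∂(Measure.pi fun _ : Fin N => μ)| ≤ K * η := by
  obtain ⟨K₁, hK₁, h₁⟩ := aux_moment μ B hB0 hB hmean hvar d 1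
  obtain ⟨K₂, hK₂, h₂⟩ := aux_moment μ B hB0 hB hmean hvar d i
  refine ⟨K₁ * 2 + (i + 1) ^ 2 * (K₂ * 5 ^ i + K₂ * 5 ^ i), by positivity,
    fun N p q η hp hq hp1 hη hη1 hpq => ?_⟩
  have hI : ∀ f : (Fin N → ℝ) → ℝ, Continuous f →
    Integrable f (Measure.pi fun _ : Fin N => μ) := aux_int μ B hB
  have cp := mlEval_cont p
  have cq := mlEval_cont q
  have hq1 : ∑ S, q S ^ 2 < 5 := by
    have : ∑ S, q S ^ 2 ≤ ∑ S, (2 * p S ^ 2 + 2 * (p S - q S) ^ 2) :=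
      Finset.sum_le_sum fun S _ => by nlinarith [sq_nonneg (2 * p S - q S)]
    rw [Finset.sum_add_distrib, ← Finset.mul_sum, ← Finset.mul_sum, hp1] at this
    nlinarith
  have m1 := h₁ N (fun S => p S - q S) (2 * η ^ 2)
    (fun S hS => by simp [hp S hS, hq S hS]) (by nlinarith [pow_pos hη 2])
  have m2 := h₂ N p 5 hp (by rw [hp1]; norm_num)
  have m3 := h₂ N q 5 hq hq1
  simp only [mlEval_sub] at m1
  rw [← integral_sub (hI _ (by fun_prop)) (hI _ (by fun_prop))]
  calc _ ≤ ∫ x, |mlEval p x ^ (i + 1) - mlEval q x ^ (i + 1)|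
        ∂(Measure.pi fun _ : Fin N => μ) := abs_integral_le_integral_abs
    _ ≤ ∫ x, (η⁻¹ * (mlEval p x - mlEval q x) ^ (2 * 1) +
      η * (i + 1) ^ 2 * (mlEval p x ^ (2 * i) + mlEval q x ^ (2 * i)))
        ∂(Measure.pi fun _ : Fin N => μ) :=
      integral_mono (hI _ (by fun_prop)) (hI _ (by fun_prop)) fun x => aux_pt _ _ η hη i
    _ = η⁻¹ * (∫ x, (mlEval p x - mlEval q x) ^ (2 * 1) ∂(Measure.pi fun _ : Fin N => μ)) +
      η * (i + 1) ^ 2 * ((∫ x, mlEval p x ^ (2 * i) ∂(Measure.pi fun _ : Fin N => μ)) +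
        ∫ x, mlEval q x ^ (2 * i) ∂(Measure.pi fun _ : Fin N => μ)) := by
      rw [integral_add (hI _ (by fun_prop)) (hI _ (by fun_prop)), integral_const_mul,
        integral_const_mul, integral_add (hI _ (by fun_prop)) (hI _ (by fun_prop))]
    _ ≤ η⁻¹ * (K₁ * (2 * η ^ 2) ^ 1) + η * (i + 1) ^ 2 * (K₂ * 5 ^ i + K₂ * 5 ^ i) := by
      gcongr
    _ = _ := by field_simp

theorem stmt16 (k d : ℕ) (hk : 1 ≤ k) (hd : 1 ≤ d)
    (μ : Measure ℝ) [IsProbabilityMeasure μ]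
    (supp : Finset ℝ) (hsupp : μ ↑supp = 1)
    (hmean : ∫ x, x ∂μ = 0) (hvar : ∫ x, x ^ 2 ∂μ = 1) :
    ∃ ξ : ℝ, 0 < ξ ∧
      ∀ (s N : ℕ), d * s ≤ N →
      ∀ q₁ q₂ : Finset (Fin N) → ℝ,
        (∀ S : Finset (Fin N), d < S.card → q₁ S = 0) →
        (∀ S : Finset (Fin N), d < S.card → q₂ S = 0) →
        -- q₁ depends only on the first d * s variables
        (∀ S : Finset (Fin N), (∃ i ∈ S, d * s ≤ (i : ℕ)) → q₁ S = 0) →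
        (∑ S : Finset (Fin N), q₁ S ^ 2 = 1) →
        ∀ η : ℝ, 0 ≤ η → η ≤ 1 →
        Real.sqrt (∑ S : Finset (Fin N), (q₁ S - q₂ S) ^ 2) ≤ η →
        Real.sqrt (∑ i ∈ Finset.range k,
          ((∫ x, (mlEval q₁ x) ^ (i + 1) ∂(Measure.pi fun _ : Fin N => μ)) -
            ∫ x, (mlEval q₂ x) ^ (i + 1) ∂(Measure.pi fun _ : Fin N => μ)) ^ 2) ≤
          ξ * η := by
  obtain ⟨B, hB0, hB⟩ := aux_bdd μ supp hsupp
  choose K hK h using fun i => aux_diff μ B hB0 hB hmean hvar d i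
  refine ⟨Real.sqrt (1 + ∑ i ∈ Finset.range k, K i ^ 2), Real.sqrt_pos.2 (by positivity), ?_⟩
  intro s N _ q₁ q₂ hq₁ hq₂ _ hn η hη0 hη1 hη
  rw [Real.sqrt_le_left hη0] at hη
  have key : ∀ i, |(∫ x, (mlEval q₁ x) ^ (i + 1) ∂(Measure.pi fun _ : Fin N => μ)) -
        ∫ x, (mlEval q₂ x) ^ (i + 1) ∂(Measure.pi fun _ : Fin N => μ)| ≤ K i * η := by
    intro i
    rcases hη0.eq_or_lt with h0 | h0
    · have hz : ∑ S, (q₁ S - q₂ S) ^ 2 = 0 :=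
        le_antisymm (by simpa [← h0] using hη) (Finset.sum_nonneg fun _ _ => sq_nonneg _)
      rw [Finset.sum_eq_zero_iff_of_nonneg fun _ _ => sq_nonneg _] at hz
      have : q₁ = q₂ := by
        funext S
        have := hz S (Finset.mem_univ _)
        exact sub_eq_zero.1 (pow_eq_zero_iff two_ne_zero |>.1 this)
      simp [this, ← h0]
    · exact h i N q₁ q₂ η hq₁ hq₂ hn h0 hη1 hη
  apply Real.sqrt_le_iff.2
  refine ⟨by positivity, ?_⟩
  rw [mul_pow, Real.sq_sqrt (by positivity), add_mul, Finset.sum_mul]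
  have : ∀ i ∈ Finset.range k,
      ((∫ x, (mlEval q₁ x) ^ (i + 1) ∂(Measure.pi fun _ : Fin N => μ)) -
        ∫ x, (mlEval q₂ x) ^ (i + 1) ∂(Measure.pi fun _ : Fin N => μ)) ^ 2 ≤
        K i ^ 2 * η ^ 2 := by
    intro i _
    rw [← sq_abs, ← mul_pow]
    exact pow_le_pow_left₀ (abs_nonneg _) (key i) 2
  have := Finset.sum_le_sum this
  nlinarith [sq_nonneg η]
end
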